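/- (Weak Harnack inequality) Let n ≥ 1 and Λ ≥ 1. There exist a constant C̃ > 0 and an exponent p ∈ (0,1), depending only on n and Λ, such that: for every r > 0, (x₀,t₀) ∈ ℝⁿ×ℝ, and every continuous u > 0 on C_r(x₀,t₀) satisfying, in the viscosity sense, u_t ≥ P⁻(D²u, Λ⁻¹, Λ) in C_r(x₀,t₀), one has ( (1/|C⁻_{r/2}(x₀,t₀)|)·∫_{C⁻_{r/2}(x₀,t₀)} u^p )^{1/p} ≤ C̃ · inf over C⁺_{r/2}(x₀,t₀) of u. -/

import Mathlib

open Set MeasureTheory Metric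
open scoped RealInnerProductSpace

noncomputable section

abbrev Eucl (n : ℕ) : Type := EuclideanSpace ℝ (Fin n)
abbrev SpaceTime (n : ℕ) : Type := Eucl n × ℝ

/-- The operator norm of an `n × n` real matrix, acting on Euclidean space. -/
noncomputable def matOpNorm {n : ℕ} (A : Matrix (Fin n) (Fin n) ℝ) : ℝ :=
  ‖(LinearMap.toContinuousLinearMap (Matrix.toEuclideanLin A))‖

/-- `F` is uniformly elliptic with ellipticity constant `Λ`. -/
def UniformlyElliptic {n : ℕ} (Λ : ℝ) (F : Matrix (Fin n) (Fin n) ℝ → ℝ) : Prop :=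
  ∀ M N : Matrix (Fin n) (Fin n) ℝ, M.IsSymm → N.IsSymm → N.PosSemidef →
    Λ⁻¹ * matOpNorm N ≤ F (M + N) - F M ∧ F (M + N) - F M ≤ Λ * matOpNorm N

/-- Pucci minimal operator `P⁻(R, a, b) = a ∑_{eᵢ>0} eᵢ + b ∑_{eᵢ<0} eᵢ`. -/
noncomputable def pucciMinus {n : ℕ} (R : Matrix (Fin n) (Fin n) ℝ) (a b : ℝ) : ℝ :=
  if h : R.IsHermitian then
    a * ∑ i, max (h.eigenvalues i) 0 + b * ∑ i, min (h.eigenvalues i) 0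
  else 0

/-- Pucci maximal operator `P⁺(R, a, b) = a ∑_{eᵢ<0} eᵢ + b ∑_{eᵢ>0} eᵢ`. -/
noncomputable def pucciPlus {n : ℕ} (R : Matrix (Fin n) (Fin n) ℝ) (a b : ℝ) : ℝ :=
  if h : R.IsHermitian then
    a * ∑ i, min (h.eigenvalues i) 0 + b * ∑ i, max (h.eigenvalues i) 0
  else 0

/-- Parabolic cylinder `E_ρ(x₀,t₀) = B_ρ(x₀) × (t₀ − ρ², t₀]`. -/
def cylE {n : ℕ} (x₀ : Eucl n) (t₀ ρ : ℝ) : Set (SpaceTime n) :=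
  (ball x₀ ρ) ×ˢ (Ioc (t₀ - ρ ^ 2) t₀)

/-- `φ` is C² in `x` and C¹ in `t` on `D`, with time derivative `φt`,
spatial gradient `gφ` and spatial Hessian `Hφ`. -/
structure ParabolicTest {n : ℕ} (φ : SpaceTime n → ℝ) (D : Set (SpaceTime n))
    (φt : SpaceTime n → ℝ) (gφ : SpaceTime n → Eucl n)
    (Hφ : SpaceTime n → Matrix (Fin n) (Fin n) ℝ) : Prop where
  contPhi : ContinuousOn φ D
  contPhit : ContinuousOn φt D
  contGrad : ContinuousOn gφ D
  contHess : ContinuousOn Hφ D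
  symmHess : ∀ p ∈ D, (Hφ p).IsSymm
  timeDeriv : ∀ p ∈ D, HasDerivWithinAt (fun s : ℝ => φ (p.1, s)) (φt p) {s : ℝ | (p.1, s) ∈ D} p.2
  spaceGrad : ∀ p ∈ D, HasGradientWithinAt (fun y => φ (y, p.2)) (gφ p) {y | (y, p.2) ∈ D} p.1
  spaceHess : ∀ p ∈ D, HasFDerivWithinAt (fun y => gφ (y, p.2))
      (LinearMap.toContinuousLinearMap (Matrix.toEuclideanLin (Hφ p))) {y | (y, p.2) ∈ D} p.1

/-- `φ` touches `u` from above at `p₀` in the set `E`. -/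
def TouchesAbove {n : ℕ} (φ u : SpaceTime n → ℝ) (E : Set (SpaceTime n)) (p₀ : SpaceTime n) :
    Prop :=
  p₀ ∈ E ∧ φ p₀ = u p₀ ∧ ∀ p ∈ E, u p ≤ φ p

/-- `φ` touches `u` from below at `p₀` in the set `E`. -/
def TouchesBelow {n : ℕ} (φ u : SpaceTime n → ℝ) (E : Set (SpaceTime n)) (p₀ : SpaceTime n) :
    Prop :=
  p₀ ∈ E ∧ φ p₀ = u p₀ ∧ ∀ p ∈ E, φ p ≤ u p

/-- `u` is a viscosity subsolution of `u_t = F(D²u)` in `D`. -/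
def ViscSub {n : ℕ} (F : Matrix (Fin n) (Fin n) ℝ → ℝ) (u : SpaceTime n → ℝ)
    (D : Set (SpaceTime n)) : Prop :=
  ∀ (φ φt : SpaceTime n → ℝ) (gφ : SpaceTime n → Eucl n)
    (Hφ : SpaceTime n → Matrix (Fin n) (Fin n) ℝ) (p₀ : SpaceTime n) (ρ : ℝ),
    0 < ρ → p₀ ∈ D → cylE p₀.1 p₀.2 ρ ⊆ D →
    ParabolicTest φ (cylE p₀.1 p₀.2 ρ) φt gφ Hφ →
    TouchesAbove φ u (cylE p₀.1 p₀.2 ρ) p₀ →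
    φt p₀ ≤ F (Hφ p₀)

/-- `u` is a viscosity supersolution of `u_t = F(D²u)` in `D`. -/
def ViscSup {n : ℕ} (F : Matrix (Fin n) (Fin n) ℝ → ℝ) (u : SpaceTime n → ℝ)
    (D : Set (SpaceTime n)) : Prop :=
  ∀ (φ φt : SpaceTime n → ℝ) (gφ : SpaceTime n → Eucl n)
    (Hφ : SpaceTime n → Matrix (Fin n) (Fin n) ℝ) (p₀ : SpaceTime n) (ρ : ℝ),
    0 < ρ → p₀ ∈ D → cylE p₀.1 p₀.2 ρ ⊆ D →
    ParabolicTest φ (cylE p₀.1 p₀.2 ρ) φt gφ Hφ →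
    TouchesBelow φ u (cylE p₀.1 p₀.2 ρ) p₀ →
    F (Hφ p₀) ≤ φt p₀

end

/-- Full cylinder `C_r(x₀,t₀) = B_r(x₀) × (t₀ − r², t₀ + r²)`. -/
def cylC {n : ℕ} (x₀ : Eucl n) (t₀ r : ℝ) : Set (SpaceTime n) :=
  ball x₀ r ×ˢ Ioo (t₀ - r ^ 2) (t₀ + r ^ 2)

/-- Lower half-cylinder `C⁻_{r/2}(x₀,t₀) = B_{r/2}(x₀) × (t₀ − r², t₀ − r²/2)`. -/
def cylCminus {n : ℕ} (x₀ : Eucl n) (t₀ r : ℝ) : Set (SpaceTime n) :=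
  ball x₀ (r / 2) ×ˢ Ioo (t₀ - r ^ 2) (t₀ - r ^ 2 / 2)

/-- Upper half-cylinder `C⁺_{r/2}(x₀,t₀) = B_{r/2}(x₀) × (t₀ + r²/2, t₀ + r²)`. -/
def cylCplus {n : ℕ} (x₀ : Eucl n) (t₀ r : ℝ) : Set (SpaceTime n) :=
  ball x₀ (r / 2) ×ˢ Ioo (t₀ + r ^ 2 / 2) (t₀ + r ^ 2)

/-- the quadratic test matrix -/
def qMat {n : ℕ} (z : Eucl n) (B : ℝ) : Matrix (Fin n) (Fin n) ℝ :=
  fun i j => z i * z j - (if i = j then B else 0)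

lemma qMat_lin {n : ℕ} (z : Eucl n) (B : ℝ) (v : Eucl n) :
    Matrix.toEuclideanLin (qMat z B) v = ⟪z, v⟫ • z - B • v := by
  ext i
  simp only [Matrix.toLpLin_apply, Matrix.mulVec, dotProduct, qMat, PiLp.sub_apply,
    PiLp.smul_apply, smul_eq_mul, PiLp.inner_apply, RCLike.inner_apply, conj_trivial,
    sub_mul, Finset.sum_sub_distrib, ite_mul, zero_mul, Finset.sum_ite_eq, Finset.mem_univ, if_true,
    Finset.sum_mul]
  congr 1
  apply Finset.sum_congr rfl
  intro j _
  ring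

lemma qMat_symm {n : ℕ} (z : Eucl n) (B : ℝ) : (qMat z B).IsSymm := by
  ext i j
  simp only [Matrix.transpose_apply, qMat, eq_comm]
  ring

lemma pucci_qMat {n : ℕ} {Λ : ℝ} (hΛ : 1 ≤ Λ) (z : Eucl n) {B : ℝ} (hB : 0 ≤ B) :
    Λ⁻¹ * ‖z‖ ^ 2 - (Λ * n) * B ≤ pucciMinus (qMat z B) Λ⁻¹ Λ := by
  have hH : (qMat z B).IsHermitian := by
    have := qMat_symm z B
    unfold Matrix.IsHermitian
    rw [Matrix.conjTranspose_eq_transpose_of_trivial]; exact this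
  have h0 : 0 < Λ := by linarith
  have hl : Λ⁻¹ ≤ Λ := by
    have : Λ⁻¹ ≤ 1 := inv_le_one_of_one_le₀ hΛ
    linarith
  have hl0 : 0 < Λ⁻¹ := inv_pos.2 h0
  unfold pucciMinus
  rw [dif_pos hH]
  have hev : ∀ i, hH.eigenvalues i = ⟪z, hH.eigenvectorBasis i⟫ ^ 2 - B := by
    intro i
    have h1 := hH.mulVec_eigenvectorBasis i
    have h2 := qMat_lin z B (hH.eigenvectorBasis i)
    rw [Matrix.toLpLin_apply, h1] at h2
    have h3 : (hH.eigenvalues i) • (hH.eigenvectorBasis i) =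
        ⟪z, hH.eigenvectorBasis i⟫ • z - B • hH.eigenvectorBasis i := by
      rw [← h2]; rfl
    have h4 := congrArg (fun w => ⟪w, hH.eigenvectorBasis i⟫) h3
    have h5 : ⟪hH.eigenvectorBasis i, hH.eigenvectorBasis i⟫ = (1:ℝ) := by
      rw [real_inner_self_eq_norm_sq, hH.eigenvectorBasis.orthonormal.1 i]; norm_num
    simp only [inner_sub_left, real_inner_smul_left, h5, mul_one] at h4
    rw [h4]; ring
  have hsum : ∑ i, ⟪z, hH.eigenvectorBasis i⟫ ^ 2 = ‖z‖ ^ 2 := by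
    have := hH.eigenvectorBasis.sum_sq_norm_inner_left z
    rw [← this]
    apply Finset.sum_congr rfl
    intro i _
    rw [Real.norm_eq_abs, sq_abs]
  rw [← hsum, Finset.mul_sum, Finset.mul_sum, Finset.mul_sum, ← Finset.sum_add_distrib]
  have : (Λ * (n:ℝ)) * B = ∑ _i : Fin n, Λ * B := by
    simp; ring
  rw [this, ← Finset.sum_sub_distrib]
  apply Finset.sum_le_sum
  intro i _
  rw [hev i]
  set s := ⟪z, hH.eigenvectorBasis i⟫ ^ 2 with hs
  have hs0 : 0 ≤ s := sq_nonneg _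
  rcases le_total 0 (s - B) with h | h
  · rw [max_eq_left h, min_eq_right h]
    nlinarith
  · rw [max_eq_right h, min_eq_left h]
    nlinarith

/-- Supersolutions tested with special quadratic polynomials. -/
def QS {n : ℕ} (lam G : ℝ) (u : SpaceTime n → ℝ) (D : Set (SpaceTime n)) : Prop :=
  ∀ (x₀ : Eucl n) (t₀ b B ρ : ℝ) (p z : Eucl n), 0 < ρ → 0 ≤ B → cylE x₀ t₀ ρ ⊆ D →
    (∀ x t, (x, t) ∈ cylE x₀ t₀ ρ →
      u (x₀, t₀) + b * (t - t₀) + ⟪p, x - x₀⟫ + (1/2) * ⟪z, x - x₀⟫ ^ 2 - (B/2) * ‖x - x₀‖ ^ 2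
        ≤ u (x, t)) →
    lam * ‖z‖ ^ 2 - G * B ≤ b

lemma inner_hfd {n : ℕ} (p x₀ x : Eucl n) :
    HasFDerivAt (fun y : Eucl n => ⟪p, y - x₀⟫) (innerSL ℝ p) x := by
  have h0 : HasFDerivAt (fun y : Eucl n => y - x₀) (ContinuousLinearMap.id ℝ (Eucl n)) x :=
    (hasFDerivAt_id x).sub_const x₀
  have := ((innerSL ℝ p).hasFDerivAt (x := x - x₀)).comp x h0
  rw [ContinuousLinearMap.comp_id] at this
  exact this

lemma ViscSup.qs {n : ℕ} {Λ : ℝ} (hΛ : 1 ≤ Λ) {u : SpaceTime n → ℝ} {D : Set (SpaceTime n)}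
    (h : ViscSup (fun H => pucciMinus H Λ⁻¹ Λ) u D) : QS Λ⁻¹ (Λ * n) u D := by
  intro x₀ t₀ b B ρ p z hρ hB hD hq
  refine (pucci_qMat hΛ z hB).trans ?_
  have hmem : (x₀, t₀) ∈ cylE x₀ t₀ ρ := by
    refine ⟨mem_ball_self hρ, ?_, le_refl _⟩
    have : 0 < ρ ^ 2 := by positivity
    simp only; linarith
  have key := h (fun q => u (x₀, t₀) + b * (q.2 - t₀) + ⟪p, q.1 - x₀⟫ + (1/2) * ⟪z, q.1 - x₀⟫ ^ 2
      - (B/2) * ‖q.1 - x₀‖ ^ 2) (fun _ => b)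
      (fun q => p + ⟪z, q.1 - x₀⟫ • z - B • (q.1 - x₀)) (fun _ => qMat z B) (x₀, t₀) ρ hρ
      (hD hmem) hD ?_ ?_
  · exact key
  · refine ⟨by fun_prop, by fun_prop, by fun_prop, by fun_prop, fun _ _ => qMat_symm z B, ?_, ?_, ?_⟩
    · intro q _
      apply HasDerivAt.hasDerivWithinAt
      have h1 : HasDerivAt (fun s : ℝ => b * (s - t₀)) b q.2 := by
        simpa using ((hasDerivAt_id q.2).sub_const t₀).const_mul b
      exact (((h1.const_add (u (x₀, t₀))).add_const (⟪p, q.1 - x₀⟫)).add_const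
        ((1/2) * ⟪z, q.1 - x₀⟫ ^ 2)).sub_const ((B/2) * ‖q.1 - x₀‖ ^ 2)
    · intro q _
      rw [hasGradientWithinAt_iff_hasFDerivWithinAt]
      apply HasFDerivAt.hasFDerivWithinAt
      have h0 : HasFDerivAt (fun y : Eucl n => y - x₀) (ContinuousLinearMap.id ℝ (Eucl n)) q.1 :=
        (hasFDerivAt_id q.1).sub_const x₀
      have h1 : HasFDerivAt (fun y : Eucl n => ⟪p, y - x₀⟫) (innerSL ℝ p) q.1 :=
        inner_hfd p x₀ q.1
      have h2 : HasFDerivAt (fun y : Eucl n => ⟪z, y - x₀⟫) (innerSL ℝ z) q.1 :=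
        inner_hfd z x₀ q.1
      have h3 := h0.norm_sq
      have h4 : HasFDerivAt (fun y : Eucl n => u (x₀, t₀) + b * (q.2 - t₀) + ⟪p, y - x₀⟫
          + (1/2) * ⟪z, y - x₀⟫ ^ 2 - (B/2) * ‖y - x₀‖ ^ 2) _ q.1 :=
        ((h1.const_add (u (x₀, t₀) + b * (q.2 - t₀))).add
        ((h2.pow 2).const_mul (1/2))).sub (h3.const_mul (B/2))
      refine h4.congr_fderiv ?_
      ext y
      simp [inner_add_left, inner_sub_left, real_inner_smul_left]
      ring
    · intro q _
      apply HasFDerivAt.hasFDerivWithinAt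
      have h0 : HasFDerivAt (fun y : Eucl n => y - x₀) (ContinuousLinearMap.id ℝ (Eucl n)) q.1 :=
        (hasFDerivAt_id q.1).sub_const x₀
      have h2 : HasFDerivAt (fun y : Eucl n => ⟪z, y - x₀⟫) (innerSL ℝ z) q.1 :=
        inner_hfd z x₀ q.1
      have h3 : HasFDerivAt (fun y : Eucl n => p + ⟪z, y - x₀⟫ • z - B • (y - x₀)) _ q.1 :=
        ((h2.smul_const z).const_add p).sub (h0.const_smul B)
      refine h3.congr_fderiv ?_
      ext1 y
      have := qMat_lin z B y
      simp [this]
  · refine ⟨hmem, by simp, ?_⟩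
    rintro ⟨x, t⟩ hxt
    exact hq x t hxt

/-- one point little-o lower quadratic expansion (backward in time). -/
def LowExp {n : ℕ} (φ : SpaceTime n → ℝ) (x : Eucl n) (t b B : ℝ) (p z : Eucl n) : Prop :=
  ∀ ε > 0, ∃ ρ > 0, ∀ x' t', (x', t') ∈ cylE x t ρ →
    φ (x, t) + b * (t' - t) + ⟪p, x' - x⟫ + (1/2) * ⟪z, x' - x⟫ ^ 2 - (B/2) * ‖x' - x‖ ^ 2
      - ε * ((t - t') + ‖x' - x‖ ^ 2) ≤ φ (x', t')

lemma cylE_mono {n : ℕ} {x : Eucl n} {t ρ ρ' : ℝ} (h0 : 0 ≤ ρ) (h : ρ ≤ ρ') :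
    cylE x t ρ ⊆ cylE x t ρ' := by
  apply Set.prod_mono (ball_subset_ball h)
  apply Ioc_subset_Ioc_left
  nlinarith

lemma comparison {n : ℕ} {lam G : ℝ} (hG : 0 ≤ G) {u φ : SpaceTime n → ℝ} {D : Set (SpaceTime n)}
    (hQ : QS lam G u D) {K : Set (Eucl n)} (hK : IsCompact K) {a c : ℝ}
    (hD : K ×ˢ Icc a c ⊆ D) (hu : ContinuousOn u (K ×ˢ Icc a c))
    (hφ : ContinuousOn φ (K ×ˢ Icc a c))
    (H : ∀ x ∈ K, ∀ t ∈ Icc a c, φ (x, t) ≤ u (x, t) ∨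
      (x ∈ interior K ∧ a < t ∧ ∃ (b B : ℝ) (p z : Eucl n), 0 ≤ B ∧
        b < lam * ‖z‖ ^ 2 - G * B ∧ LowExp φ x t b B p z)) :
    ∀ x ∈ K, ∀ t ∈ Icc a c, φ (x, t) ≤ u (x, t) := by
  intro x₁ hx₁ t₁ ht₁
  by_contra hcon
  push Not at hcon
  obtain ⟨⟨x, t⟩, hxt, hmin⟩ := (hK.prod isCompact_Icc).exists_isMinOn
    ⟨(x₁, t₁), hx₁, ht₁⟩ (hu.sub hφ)
  have hm1 : u (x, t) - φ (x, t) ≤ u (x₁, t₁) - φ (x₁, t₁) := hmin (show (x₁, t₁) ∈ _ from ⟨hx₁, ht₁⟩)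
  obtain ⟨hx, ht⟩ := hxt
  simp only at hx ht
  rcases H x hx t ht with h | ⟨hxi, hat, b, B, p, z, hB, hlt, hexp⟩
  · linarith
  set η := (lam * ‖z‖ ^ 2 - G * B - b) with hη
  have hη0 : 0 < η := by rw [hη]; linarith
  set ε := η / (2 * (1 + 2 * G)) with hε
  have hε0 : 0 < ε := by positivity
  have hεη : ε * (1 + 2 * G) = η / 2 := by rw [hε]; field_simp
  obtain ⟨ρ₁, hρ₁, he⟩ := hexp ε hε0
  obtain ⟨ρ₂, hρ₂, hball⟩ := Metric.isOpen_iff.1 isOpen_interior x hxi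
  have hsq : 0 < Real.sqrt (t - a) := Real.sqrt_pos.2 (by linarith)
  set ρ := min ρ₁ (min ρ₂ (Real.sqrt (t - a))) with hρdef
  have hρ : 0 < ρ := lt_min hρ₁ (lt_min hρ₂ hsq)
  have hsub : cylE x t ρ ⊆ K ×ˢ Icc a c := by
    rintro ⟨x', t'⟩ ⟨h1, h2⟩
    refine ⟨interior_subset (hball (ball_subset_ball ((min_le_right _ _).trans (min_le_left _ _)) h1)),
      ?_, h2.2.trans ht.2⟩
    have h3 : ρ ^ 2 ≤ t - a := by
      have : ρ ≤ Real.sqrt (t - a) := (min_le_right _ _).trans (min_le_right _ _)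
      calc ρ ^ 2 ≤ (Real.sqrt (t - a)) ^ 2 := by gcongr
        _ = t - a := Real.sq_sqrt (by linarith)
    have := h2.1
    simp only at this ⊢; linarith
  have := hQ x t (b + ε) (B + 2 * ε) ρ p z hρ (by positivity) (hsub.trans hD) ?_
  · nlinarith
  intro x' t' hx't'
  have h1 := he x' t' (cylE_mono hρ.le (min_le_left _ _) hx't')
  have h2 : u (x, t) - φ (x, t) ≤ u (x', t') - φ (x', t') := hmin (hsub hx't')
  nlinarith

lemma cylE_eventually {n : ℕ} {x : Eucl n} {t : ℝ} {P : SpaceTime n → Prop}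
    (h : ∀ᶠ q in nhds (x, t), P q) : ∃ ρ > 0, ∀ q ∈ cylE x t ρ, P q := by
  obtain ⟨r, hr, hb⟩ := Metric.eventually_nhds_iff_ball.1 h
  refine ⟨min r 1, lt_min hr one_pos, ?_⟩
  rintro ⟨x', t'⟩ ⟨h1, h2, h3⟩
  apply hb
  rw [mem_ball, Prod.dist_eq]
  have hm0 : 0 < min r 1 := lt_min hr one_pos
  have hm : min r 1 ≤ 1 := min_le_right _ _
  have hm' : min r 1 ≤ r := min_le_left _ _
  refine max_lt (lt_of_lt_of_le h1 hm') ?_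
  simp only at h2 h3 ⊢
  rw [Real.dist_eq, abs_lt]
  constructor <;> nlinarith

/-- the moving bump -/
noncomputable def bump {n : ℕ} (A : ℝ) (q : ℕ) (W1 β t1 : ℝ) (y v : Eucl n) (P : SpaceTime n) : ℝ :=
  A * ((W1 + β * (P.2 - t1)) ^ q)⁻¹ *
    (max (W1 + β * (P.2 - t1) - ‖P.1 - (y + (P.2 - t1) • v)‖ ^ 2) 0) ^ 2

lemma bernoulli_inv {W0 β h : ℝ} (hβ : 0 ≤ β) (hh : h ≤ 0) (hW : 0 < W0 + β * h) (q : ℕ) :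
    (W0 ^ q)⁻¹ * (1 - q * β / W0 * h) ≤ ((W0 + β * h) ^ q)⁻¹ := by
  have hbh : β * h ≤ 0 := mul_nonpos_of_nonneg_of_nonpos hβ hh
  have hW0 : 0 < W0 := by linarith
  have h1 : (1:ℝ) + q * (-(β * h) / W0) ≤ (1 + (-(β * h) / W0)) ^ q := by
    apply one_add_mul_le_pow
    have : 0 ≤ -(β * h) / W0 := div_nonneg (by linarith) hW0.le
    linarith
  have h2 : 1 + (-(β * h) / W0) ≤ W0 / (W0 + β * h) := by
    rw [le_div_iff₀ hW]
    have : (1 + -(β * h) / W0) * (W0 + β * h) = W0 - (β * h) ^ 2 / W0 := by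
      field_simp; ring
    rw [this]
    have : 0 ≤ (β * h) ^ 2 / W0 := by positivity
    linarith
  have h3 : (1 + (-(β * h) / W0)) ^ q ≤ (W0 / (W0 + β * h)) ^ q := by
    have : 0 ≤ -(β * h) / W0 := div_nonneg (by linarith) hW0.le
    gcongr
  calc (W0 ^ q)⁻¹ * (1 - q * β / W0 * h) = (W0 ^ q)⁻¹ * (1 + q * (-(β * h) / W0)) := by ring
    _ ≤ (W0 ^ q)⁻¹ * (W0 / (W0 + β * h)) ^ q := by
        gcongr; exact h1.trans h3
    _ = ((W0 + β * h) ^ q)⁻¹ := by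
        rw [div_pow]; field_simp

lemma bump_aux {g0 C1 e h D ε : ℝ} (hg : 0 ≤ g0) (hC : 0 ≤ C1) (he : 0 ≤ e) (hh : 0 ≤ -h)
    (hD : 0 ≤ D) (h1 : e * ((g0 + 1) * (2 + C1)) = ε) :
    g0 * ((-h) * e + (C1 * (-h) + D) * e) ≤ ε * ((-h) + D) := by
  rw [← h1]
  have h2 : 0 ≤ (-h) * e + (C1 * (-h) + D) * e := by positivity
  have h3 : 0 ≤ (g0 + 1) * (e * ((1 + C1) * D + (-h))) := by positivity
  have : e * ((g0 + 1) * (2 + C1)) * (-h + D) - g0 * ((-h) * e + (C1 * (-h) + D) * e) =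
    (g0 + 1) * (e * ((1 + C1) * D + (-h))) + ((-h) * e + (C1 * (-h) + D) * e) := by ring
  linarith

set_option maxHeartbeats 1000000 in
lemma bump_lowExp {n : ℕ} {A : ℝ} (hA : 0 ≤ A) (q : ℕ) {W1 β t1 : ℝ} (hβ : 0 ≤ β) (y v x : Eucl n)
    (t W0 s0 g0 : ℝ) (z0 : Eucl n) (hz0 : z0 = x - (y + (t - t1) • v))
    (hW0 : W0 = W1 + β * (t - t1)) (hW0p : 0 < W0) (hs0 : s0 = W0 - ‖z0‖ ^ 2) (hs0p : 0 < s0)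
    (hg0 : g0 = A * (W0 ^ q)⁻¹) :
    LowExp (bump A q W1 β t1 y v) x t
      (g0 * (2 * s0 * (β + 2 * ⟪z0, v⟫) - (q * β / W0) * s0 ^ 2))
      (g0 * (4 * s0)) ((g0 * (-4 * s0)) • z0) (Real.sqrt (8 * g0) • z0) := by
  intro ε hε
  have hg0p : 0 ≤ g0 := by rw [hg0]; positivity
  set γ := β + 2 * ⟪z0, v⟫ with hγ
  set κ := q * β / W0 with hκ
  have hκ0 : 0 ≤ κ := by positivity
  set C1 := |γ| + 1 with hC1
  have hC1p : 0 < C1 := by positivity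
  set ε' := ε / ((g0 + 1) * (2 + C1)) with hε'
  have hε'p : 0 < ε' := by positivity
  -- the continuous functions
  let S : SpaceTime n → ℝ := fun P => W1 + β * (P.2 - t1) - ‖P.1 - (y + (P.2 - t1) • v)‖ ^ 2
  let e3 : SpaceTime n → ℝ := fun P => 2 * ⟪P.1 - x, v⟫ - (P.2 - t) * ‖v‖ ^ 2
  let e1 : SpaceTime n → ℝ := fun P => 2 * s0 * e3 P - κ * ((S P) ^ 2 - s0 ^ 2)
  let e2 : SpaceTime n → ℝ := fun P => (S P - s0) - 2 * ⟪z0, P.1 - x⟫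
  have hSc : Continuous S := by fun_prop
  have he3c : Continuous e3 := by fun_prop
  have he1c : Continuous e1 := by fun_prop
  have he2c : Continuous e2 := by fun_prop
  have hS0 : S (x, t) = s0 := by simp only [S]; rw [hs0, hz0, hW0]
  have he30 : e3 (x, t) = 0 := by simp [e3]
  have he10 : e1 (x, t) = 0 := by simp only [e1, he30, hS0]; ring
  have he20 : e2 (x, t) = 0 := by simp [e2, hS0]
  have E1 : ∀ᶠ P in nhds (x, t), |e1 P| < ε' := by
    have := he1c.abs.tendsto (x, t)
    rw [he10, abs_zero] at this
    exact this.eventually (gt_mem_nhds hε'p)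
  have E2 : ∀ᶠ P in nhds (x, t), |e2 P| < ε' := by
    have := he2c.abs.tendsto (x, t)
    rw [he20, abs_zero] at this
    exact this.eventually (gt_mem_nhds hε'p)
  have E3 : ∀ᶠ P in nhds (x, t), |e3 P| < 1 := by
    have := he3c.abs.tendsto (x, t)
    rw [he30, abs_zero] at this
    exact this.eventually (gt_mem_nhds one_pos)
  have E4 : ∀ᶠ P in nhds (x, t), 0 < S P := by
    have := hSc.tendsto (x, t)
    rw [hS0] at this
    exact this.eventually (lt_mem_nhds hs0p)
  obtain ⟨ρ, hρ, hb⟩ := cylE_eventually (E1.and (E2.and (E3.and E4)))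
  refine ⟨ρ, hρ, ?_⟩
  intro x' t' hx'
  obtain ⟨b1, b2, b3, b4⟩ := hb _ hx'
  have htt : t' ≤ t := hx'.2.2
  set d := x' - x with hd
  set h := t' - t with hh
  have hh0 : h ≤ 0 := by rw [hh]; linarith
  have hWt : W1 + β * (t' - t1) = W0 + β * h := by rw [hW0, hh]; ring
  have hvec : x' - (y + (t' - t1) • v) = z0 + d - h • v := by
    rw [hz0, hd, hh]; module
  set i1 := ⟪z0, d⟫ with hi1
  set i2 := ⟪z0, v⟫ with hi2
  set i3 := ⟪d, v⟫ with hi3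
  have hnorm : ‖z0 + d - h • v‖ ^ 2 = ‖z0‖ ^ 2 + 2 * i1 - 2 * h * i2 + ‖d‖ ^ 2 - 2 * h * i3
      + h ^ 2 * ‖v‖ ^ 2 := by
    rw [norm_sub_sq_real, norm_add_sq_real, inner_add_left, real_inner_smul_right,
      real_inner_smul_right, norm_smul, mul_pow, Real.norm_eq_abs, sq_abs]
    ring
  have hS' : S (x', t') = s0 + (γ * h - 2 * i1 - ‖d‖ ^ 2 + 2 * h * i3 - h ^ 2 * ‖v‖ ^ 2) := by
    simp only [S]
    rw [hvec, hnorm, hWt, hs0, hγ]; ring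
  have hWpos : 0 < W0 + β * h := by
    have : S (x', t') ≤ W1 + β * (t' - t1) := by simp only [S]; nlinarith [sq_nonneg ‖x' - (y + (t' - t1) • v)‖]
    rw [← hWt]; linarith
  have hbump' : bump A q W1 β t1 y v (x', t') = A * ((W0 + β * h) ^ q)⁻¹ * (S (x', t')) ^ 2 := by
    simp only [bump]
    rw [← hWt, max_eq_left b4.le]
  have hbump : bump A q W1 β t1 y v (x, t) = g0 * s0 ^ 2 := by
    simp only [bump]
    have : W1 + β * (t - t1) - ‖x - (y + (t - t1) • v)‖ ^ 2 = s0 := hS0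
    rw [this, max_eq_left hs0p.le, hg0, hW0]
  have hlow : g0 * (1 - κ * h) * (S (x', t')) ^ 2 ≤ bump A q W1 β t1 y v (x', t') := by
    rw [hbump']
    have := bernoulli_inv hβ hh0 hWpos q
    have h2 : g0 * (1 - κ * h) ≤ A * ((W0 + β * h) ^ q)⁻¹ := by
      rw [hg0, mul_assoc]; gcongr
    gcongr
  refine le_trans ?_ hlow
  rw [hbump, real_inner_smul_left, real_inner_smul_left, mul_pow, Real.sq_sqrt (by positivity), ← hi1]
  have hE3 : e3 (x', t') = 2 * i3 - h * ‖v‖ ^ 2 := rfl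
  have hE1 : e1 (x', t') = 2 * s0 * e3 (x', t') - κ * ((S (x', t')) ^ 2 - s0 ^ 2) := rfl
  have hE2 : e2 (x', t') = (S (x', t') - s0) - 2 * i1 := rfl
  set E := γ * h - ‖d‖ ^ 2 + h * e3 (x', t') with hE
  have key : g0 * (1 - κ * h) * (S (x', t')) ^ 2 =
      g0 * s0 ^ 2 + g0 * (2 * s0 * γ - κ * s0 ^ 2) * h + g0 * (-4 * s0) * i1 +
      1 / 2 * (8 * g0 * i1 ^ 2) - g0 * (4 * s0) / 2 * ‖d‖ ^ 2
      + g0 * (h * e1 (x', t') + E * e2 (x', t')) := by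
    rw [hE, hE1, hE2, hE3, hS']; ring
  rw [key]
  have b5 : |E| ≤ C1 * (-h) + ‖d‖ ^ 2 := by
    rw [hE, abs_le]
    rw [abs_lt] at b3
    have h1 := neg_abs_le γ
    have h2 := le_abs_self γ
    rw [hC1]
    have hn : 0 ≤ -h := by linarith
    have m1 := mul_nonneg (sub_nonneg.2 h1) hn
    have m2 := mul_nonneg (sub_nonneg.2 h2) hn
    have m3 := mul_nonneg (sub_nonneg.2 b3.1.le) hn
    have m4 := mul_nonneg (sub_nonneg.2 b3.2.le) hn
    have m5 := sq_nonneg ‖d‖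
    constructor <;> linarith
  have b6 : |h * e1 (x', t') + E * e2 (x', t')| ≤ (-h) * ε' + (C1 * (-h) + ‖d‖ ^ 2) * ε' := by
    refine (abs_add_le _ _).trans ?_
    rw [abs_mul, abs_mul, abs_of_nonpos hh0]
    have : 0 ≤ C1 * (-h) + ‖d‖ ^ 2 := (abs_nonneg _).trans b5
    gcongr
    linarith
  have b7 := neg_le_of_abs_le b6
  have b8 : g0 * ((-h) * ε' + (C1 * (-h) + ‖d‖ ^ 2) * ε') ≤ ε * ((-h) + ‖d‖ ^ 2) := by
    have h1 : ε' * ((g0 + 1) * (2 + C1)) = ε := by rw [hε']; field_simp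
    exact bump_aux hg0p hC1p.le hε'p.le (by linarith) (sq_nonneg _) h1
  have b9 : t - t' = -h := by rw [hh]; ring
  rw [b9]
  have b10 := mul_le_mul_of_nonneg_left b7 hg0p
  linarith

lemma bump_strict {lam G g0 s0 W0 β β0 K0 Z iv : ℝ} {q : ℕ} (hlam : 0 < lam) (hg0 : 0 < g0)
    (hs0 : 0 < s0) (hW0 : 0 < W0) (hZ : Z = W0 - s0) (hβ0 : 0 < β0) (hβ : β0 ≤ β)
    (hK : 2 * (β + 2 * iv) + 4 * G + 8 * lam ≤ K0) (hcond : K0 ^ 2 < 32 * lam * q * β0) :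
    g0 * (2 * s0 * (β + 2 * iv) - (q * β / W0) * s0 ^ 2) <
      lam * (8 * g0 * Z) - G * (g0 * (4 * s0)) := by
  have hq : 0 ≤ (q:ℝ) := Nat.cast_nonneg q
  have hqb : 32 * lam * q * β0 ≤ 32 * lam * q * β := by gcongr
  have hc : K0 ^ 2 < 32 * lam * (q * β) := by linarith
  have hqβ : 0 < q * β := by
    by_contra h
    push Not at h
    nlinarith [sq_nonneg K0, mul_nonneg hlam.le (neg_nonneg.2 h)]
  have h1 : 0 < 8 * lam * W0 ^ 2 - K0 * s0 * W0 + (q * β) * s0 ^ 2 := by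
    have h2 : 0 < 4 * (q * β) * (8 * lam * W0 ^ 2 - K0 * s0 * W0 + (q * β) * s0 ^ 2) := by
      have : 4 * (q * β) * (8 * lam * W0 ^ 2 - K0 * s0 * W0 + (q * β) * s0 ^ 2) =
        (2 * (q * β) * s0 - K0 * W0) ^ 2 + (32 * lam * (q * β) - K0 ^ 2) * W0 ^ 2 := by ring
      rw [this]
      have : 0 < (32 * lam * (q * β) - K0 ^ 2) * W0 ^ 2 := by
        apply mul_pos _ (by positivity); linarith
      positivity
    exact pos_of_mul_pos_right h2 (by positivity)
  have h3 : 0 < 8 * lam * W0 - K0 * s0 + (q * β / W0) * s0 ^ 2 := by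
    have : 8 * lam * W0 - K0 * s0 + (q * β / W0) * s0 ^ 2 =
      (8 * lam * W0 ^ 2 - K0 * s0 * W0 + (q * β) * s0 ^ 2) / W0 := by field_simp
    rw [this]; positivity
  have h4 : (2 * (β + 2 * iv) + 4 * G + 8 * lam) * s0 ≤ K0 * s0 := by gcongr
  have h5 : 0 < g0 * (8 * lam * W0 - (2 * (β + 2 * iv) + 4 * G + 8 * lam) * s0 + (q * β / W0) * s0 ^ 2) := by
    apply mul_pos hg0; linarith
  rw [hZ]
  linarith

lemma bump_continuousOn {n : ℕ} (A : ℝ) (q : ℕ) {W1 β t1 : ℝ} (hW1 : 0 < W1) (hβ : 0 ≤ β)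
    (y v : Eucl n) (K : Set (Eucl n)) (t2 : ℝ) :
    ContinuousOn (bump A q W1 β t1 y v) (K ×ˢ Icc t1 t2) := by
  unfold bump
  apply ContinuousOn.mul
  · apply ContinuousOn.mul continuousOn_const
    apply ContinuousOn.inv₀ (by fun_prop)
    rintro ⟨x, t⟩ ⟨_, ht⟩
    have : 0 ≤ β * (t - t1) := mul_nonneg hβ (by have := ht.1; simp only at this; linarith)
    have : 0 < W1 + β * (t - t1) := by linarith
    simp only; positivity
  · apply Continuous.continuousOn
    fun_prop

lemma propagation {n : ℕ} {lam G : ℝ} (hlam : 0 < lam) (hG : 0 ≤ G) {q : ℕ}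
    {u : SpaceTime n → ℝ} {D : Set (SpaceTime n)} (hQ : QS lam G u D) (hu : ContinuousOn u D)
    (hpos : ∀ P ∈ D, 0 ≤ u P) {x₀ y x : Eucl n} {κ t1 t2 R1 R2 m β0 β1 V : ℝ}
    (ht : t1 < t2) (hR1 : 0 < R1) (hR12 : R1 < R2) (hm : 0 < m)
    (hD : closedBall x₀ κ ×ˢ Icc t1 t2 ⊆ D)
    (hy : dist y x₀ + R2 ≤ κ) (hx : dist x x₀ + R2 ≤ κ)
    (hinit : ∀ w ∈ ball y R1, m ≤ u (w, t1))
    (hβ0 : 0 < β0) (hβ0' : β0 * (t2 - t1) ≤ R2 ^ 2 - R1 ^ 2)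
    (hβ1 : R2 ^ 2 - R1 ^ 2 ≤ β1 * (t2 - t1)) (hV : R2 * dist x y ≤ V * (t2 - t1))
    (hcond : (2 * β1 + 4 * V + 4 * G + 8 * lam) ^ 2 < 32 * lam * q * β0) :
    m * (R1 / R2) ^ (2 * q) ≤ u (x, t2) := by
  have hT : 0 < t2 - t1 := by linarith
  have hR2 : 0 < R2 := by linarith
  set β := (R2 ^ 2 - R1 ^ 2) / (t2 - t1) with hβ
  have hββ0 : β0 ≤ β := by rw [hβ, le_div_iff₀ hT]; exact hβ0'
  have hββ1 : β ≤ β1 := by rw [hβ, div_le_iff₀ hT]; exact hβ1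
  have hβT : β * (t2 - t1) = R2 ^ 2 - R1 ^ 2 := by rw [hβ]; field_simp
  have hβp : 0 < β := by linarith
  set v := (t2 - t1)⁻¹ • (x - y) with hv
  have hvn : R2 * ‖v‖ ≤ V := by
    rw [hv, norm_smul, Real.norm_of_nonneg (by positivity), ← dist_eq_norm]
    rw [show R2 * ((t2 - t1)⁻¹ * dist x y) = (R2 * dist x y) / (t2 - t1) by field_simp]
    rw [div_le_iff₀ hT]; exact hV
  set A := m * (R1 ^ 2) ^ q / (R1 ^ 2) ^ 2 with hA
  have hA0 : 0 < A := by positivity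
  have hWle : ∀ t ∈ Icc t1 t2, R1 ^ 2 + β * (t - t1) ≤ R2 ^ 2 := by
    intro t ht
    have : β * (t - t1) ≤ β * (t2 - t1) := by gcongr; exact ht.2
    linarith
  have hWge : ∀ t ∈ Icc t1 t2, R1 ^ 2 ≤ R1 ^ 2 + β * (t - t1) := by
    intro t ht
    have : 0 ≤ β * (t - t1) := mul_nonneg hβp.le (by linarith [ht.1])
    linarith
  have main := comparison (φ := bump A q (R1 ^ 2) β t1 y v) hG hQ (isCompact_closedBall x₀ κ) hD
    (hu.mono hD) (bump_continuousOn A q (by positivity) hβp.le y v _ t2) ?_ x ?_ t2 ⟨ht.le, le_refl _⟩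
  · refine le_trans ?_ main
    have e1 : x - (y + (t2 - t1) • v) = 0 := by
      rw [hv, smul_smul, mul_inv_cancel₀ hT.ne']; module
    simp only [bump]
    rw [e1, hβT, norm_zero]
    rw [show R1 ^ 2 + (R2 ^ 2 - R1 ^ 2) = R2 ^ 2 by ring, max_eq_left (by have := sq_nonneg R2; linarith), hA]
    have e2 : m * (R1 ^ 2) ^ q / (R1 ^ 2) ^ 2 * ((R2 ^ 2) ^ q)⁻¹ * (R2 ^ 2 - 0 ^ 2) ^ 2 =
      m * (R1 / R2) ^ (2 * q) * (R2 ^ 2 / R1 ^ 2) ^ 2 := by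
      rw [pow_mul, div_pow, div_pow]
      field_simp; ring
    rw [e2]
    have e3 : 1 ≤ (R2 ^ 2 / R1 ^ 2) ^ 2 := by
      apply one_le_pow₀
      rw [one_le_div (by positivity)]
      gcongr
    have e4 : 0 ≤ m * (R1 / R2) ^ (2 * q) := by positivity
    nlinarith
  · intro w hw t htt
    by_cases hcase : bump A q (R1 ^ 2) β t1 y v (w, t) ≤ u (w, t)
    · left; exact hcase
    right
    push Not at hcase
    have hup := hpos (w, t) (hD ⟨hw, htt⟩)
    set z0 := w - (y + (t - t1) • v) with hz0
    set W0 := R1 ^ 2 + β * (t - t1) with hW0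
    set s0 := W0 - ‖z0‖ ^ 2 with hs0
    have hW0p : 0 < W0 := by have := hWge t htt; have : 0 < R1 ^ 2 := by positivity
                             linarith
    have hbv : bump A q (R1 ^ 2) β t1 y v (w, t) = A * (W0 ^ q)⁻¹ * (max s0 0) ^ 2 := rfl
    have hs0p : 0 < s0 := by
      by_contra h
      push Not at h
      rw [hbv, max_eq_right h] at hcase
      norm_num at hcase
      linarith
    have hz0n : ‖z0‖ < R2 := by
      have h1 : ‖z0‖ ^ 2 < R2 ^ 2 := by have := hWle t htt; linarith
      exact lt_of_pow_lt_pow_left₀ 2 hR2.le h1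
    set g0 := A * (W0 ^ q)⁻¹ with hg0
    have hg0p : 0 < g0 := by positivity
    refine ⟨?_, ?_, _, _, _, _, ?_, ?_,
      bump_lowExp hA0.le q hβp.le y v w t W0 s0 g0 z0 hz0 hW0 hW0p hs0 hs0p hg0⟩
    · have hc : y + (t - t1) • v ∈ closedBall x₀ (κ - R2) := by
        have e : y + (t - t1) • v = y + ((t - t1) / (t2 - t1)) • (x - y) := by
          rw [hv, smul_smul, div_eq_mul_inv]
        rw [e]
        refine (convex_closedBall x₀ (κ - R2)).add_smul_sub_mem ?_ ?_ ⟨?_, ?_⟩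
        · rw [mem_closedBall]; linarith
        · rw [mem_closedBall]; linarith
        · exact div_nonneg (by linarith [htt.1]) hT.le
        · rw [div_le_one hT]; linarith [htt.2]
      have hsub : ball (y + (t - t1) • v) R2 ⊆ closedBall x₀ κ := by
        intro w' hw'
        rw [mem_ball] at hw'
        rw [mem_closedBall] at hc ⊢
        have := dist_triangle w' (y + (t - t1) • v) x₀
        linarith
      apply interior_maximal hsub isOpen_ball
      rw [mem_ball, dist_eq_norm]; exact hz0n
    · rcases lt_or_eq_of_le htt.1 with h | h
      · exact h
      exfalso
      subst h
      have e1 : W0 = R1 ^ 2 := by rw [hW0]; ring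
      have e2 : z0 = w - y := by rw [hz0]; simp
      have hwb : w ∈ ball y R1 := by
        rw [mem_ball, dist_eq_norm, ← e2]
        have h1 : ‖z0‖ ^ 2 < R1 ^ 2 := by linarith
        exact lt_of_pow_lt_pow_left₀ 2 hR1.le h1
      have h1 := hinit w hwb
      rw [hbv, max_eq_left hs0p.le, hg0, hA, e1] at hcase
      have h2 : s0 ^ 2 ≤ (R1 ^ 2) ^ 2 := by
        have : s0 ≤ R1 ^ 2 := by rw [hs0, e1]; nlinarith [sq_nonneg ‖z0‖]
        gcongr
      have h3 : m * (R1 ^ 2) ^ q / (R1 ^ 2) ^ 2 * ((R1 ^ 2) ^ q)⁻¹ * s0 ^ 2 ≤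
          m * (R1 ^ 2) ^ q / (R1 ^ 2) ^ 2 * ((R1 ^ 2) ^ q)⁻¹ * (R1 ^ 2) ^ 2 := by gcongr
      have h4 : m * (R1 ^ 2) ^ q / (R1 ^ 2) ^ 2 * ((R1 ^ 2) ^ q)⁻¹ * (R1 ^ 2) ^ 2 = m := by
        field_simp
      linarith
    · positivity
    · rw [norm_smul, mul_pow, Real.norm_of_nonneg (by positivity), Real.sq_sqrt (by positivity)]
      rw [show lam * (8 * g0 * ‖z0‖ ^ 2) = lam * (8 * g0 * (W0 - s0)) by rw [hs0]; ring]
      refine bump_strict hlam hg0p hs0p hW0p rfl hβ0 hββ0 ?_ hcond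
      have h1 : ⟪z0, v⟫ ≤ ‖z0‖ * ‖v‖ := real_inner_le_norm _ _
      have h2 : ‖z0‖ * ‖v‖ ≤ R2 * ‖v‖ := by gcongr
      linarith
  · rw [mem_closedBall]; linarith

/-- general quadratic test function -/
noncomputable def quadF {n : ℕ} (c k A r B : ℝ) (y e x₀ : Eucl n) (P : SpaceTime n) : ℝ :=
  c + k * P.2 - 16 * ‖P.1 - y‖ ^ 2 + (1/2) * A * (⟪e, P.1 - x₀⟫ + r) ^ 2 - (B/2) * ‖P.1 - x₀‖ ^ 2

lemma quadF_continuous {n : ℕ} (c k A r B : ℝ) (y e x₀ : Eucl n) :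
    Continuous (quadF c k A r B y e x₀) := by
  unfold quadF; fun_prop

lemma quadF_lowExp {n : ℕ} (c k r B : ℝ) {A : ℝ} (hA : 0 ≤ A) (y e x₀ x : Eucl n) (t : ℝ) :
    LowExp (quadF c k A r B y e x₀) x t k (32 + B)
      ((-32 : ℝ) • (x - y) + (A * (⟪e, x - x₀⟫ + r)) • e - B • (x - x₀)) (Real.sqrt A • e) := by
  intro ε hε
  refine ⟨1, one_pos, ?_⟩
  intro x' t' hx'
  have ht : t' ≤ t := hx'.2.2
  simp only [quadF]
  set d := x' - x with hd
  have e1 : x' - y = (x - y) + d := by rw [hd]; module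
  have e2 : x' - x₀ = (x - x₀) + d := by rw [hd]; module
  rw [e1, e2, norm_add_sq_real, norm_add_sq_real, inner_add_right, inner_sub_left, inner_add_left,
    real_inner_smul_left, real_inner_smul_left, real_inner_smul_left, real_inner_smul_left,
    mul_pow, Real.sq_sqrt hA]
  have : 0 ≤ ε * (t - t' + ‖d‖ ^ 2) := by
    have : 0 ≤ t - t' := by linarith
    positivity
  linarith

noncomputable def para {n : ℕ} (y : Eucl n) (h : ℝ) (x : Eucl n) (t : ℝ) : ℝ :=
  h + 8 * t - 16 * ‖x - y‖ ^ 2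

def Contact {n : ℕ} (u : SpaceTime n → ℝ) (y : Eucl n) (h : ℝ) (x : Eucl n) (t : ℝ) : Prop :=
  ‖x‖ ≤ 7/8 ∧ 1/16 ≤ t ∧ t ≤ 1/2 ∧ -1 ≤ h ∧ h ≤ -1/2 ∧ u (x, t) = para y h x t ∧
    ∀ x' ∈ ball (0 : Eucl n) 1, ∀ t', 0 < t' → t' ≤ t → para y h x' t' ≤ u (x', t')

/-- difference of two paraboloids, an affine function -/
noncomputable def ell {n : ℕ} (y0 y1 : Eucl n) (h0 h1 : ℝ) (x : Eucl n) : ℝ :=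
  h1 - h0 - 16 * (‖x - y1‖ ^ 2 - ‖x - y0‖ ^ 2)

lemma ell_affine {n : ℕ} (y0 y1 : Eucl n) (h0 h1 : ℝ) (x x' : Eucl n) :
    ell y0 y1 h0 h1 x' = ell y0 y1 h0 h1 x + ⟪(32:ℝ) • (y1 - y0), x' - x⟫ := by
  unfold ell
  have e1 : x' - y1 = (x - y1) + (x' - x) := by module
  have e2 : x' - y0 = (x - y0) + (x' - x) := by module
  rw [e1, e2, norm_add_sq_real, norm_add_sq_real, real_inner_smul_left]
  have e3 : y1 - y0 = (x - y0) - (x - y1) := by module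
  have e4 : ⟪y1 - y0, x' - x⟫ = ⟪x - y0, x' - x⟫ - ⟪x - y1, x' - x⟫ := by
    rw [e3, inner_sub_left]
  rw [e4]; ring

lemma para_ell {n : ℕ} (y0 y1 : Eucl n) (h0 h1 : ℝ) (x : Eucl n) (t : ℝ) :
    para y1 h1 x t = para y0 h0 x t + ell y0 y1 h0 h1 x := by
  unfold ell para; ring

section
variable {n : ℕ} {lam G : ℝ} {u : SpaceTime n → ℝ}

lemma contact_drop (hG : 0 ≤ G)
    (hQ : QS lam G u (ball 0 1 ×ˢ Ioo 0 1)) (hu : ContinuousOn u (ball 0 1 ×ˢ Ioo 0 1))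
    (hpos : ∀ P ∈ (ball (0 : Eucl n) 1 ×ˢ Ioo (0:ℝ) 1), 0 ≤ u P)
    {y0 y1 : Eucl n} {h0 h1 : ℝ} {x0 x1 : Eucl n} {t0 t1 ρ : ℝ}
    (c0 : Contact u y0 h0 x0 t0) (c1 : Contact u y1 h1 x1 t1) (ht : t0 ≤ t1)
    (hρ1 : ρ ≤ 1/16) (hx : ‖x1 - x0‖ ≤ ρ) (htρ : t1 - t0 ≤ ρ ^ 2) :
    -((1033 + 2080 * G) * ρ ^ 2) ≤ ell y0 y1 h0 h1 x1 := by
  obtain ⟨a1, a2, a3, a4, a5, a6, a7⟩ := c0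
  obtain ⟨b1, b2, b3, b4, b5, b6, b7⟩ := c1
  have hsub : closedBall x0 (1/16) ×ˢ Icc t0 t1 ⊆ ball (0 : Eucl n) 1 ×ˢ Ioo (0:ℝ) 1 := by
    rintro ⟨x, t⟩ ⟨hx, ht⟩
    simp only [mem_closedBall, dist_eq_norm] at hx
    refine ⟨?_, by simp only; linarith [ht.1], by simp only; linarith [ht.2]⟩
    simp only [mem_ball, dist_zero_right]
    have : ‖x‖ ≤ ‖x - x0‖ + ‖x0‖ := by simpa using norm_add_le (x - x0) x0
    linarith
  set Kc := 9 + 2080 * G with hKc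
  have hKc0 : 0 ≤ Kc := by positivity
  have main := comparison (φ := quadF (h0 + Kc * t0) (8 - Kc) 0 0 2048 y0 0 x0) hG hQ
    (isCompact_closedBall x0 (1/16)) hsub (hu.mono hsub) (quadF_continuous _ _ _ _ _ _ _ _).continuousOn
    ?_ x1 ?_ t1 ⟨ht, le_refl _⟩
  · rw [b6, para_ell y0 y1 h0 h1] at main
    simp only [quadF] at main
    unfold para at main
    have : ‖x1 - x0‖ ^ 2 ≤ ρ ^ 2 := by gcongr
    have : Kc * (t1 - t0) ≤ Kc * ρ ^ 2 := by gcongr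
    rw [hKc] at *
    linarith
  · intro x hxx t htt
    have hD := hsub (show (x, t) ∈ _ from ⟨hxx, htt⟩)
    have hval : quadF (h0 + Kc * t0) (8 - Kc) 0 0 2048 y0 0 x0 (x, t) =
        para y0 h0 x t - Kc * (t - t0) - 1024 * ‖x - x0‖ ^ 2 := by
      simp only [quadF, para]; ring
    have hKt : 0 ≤ Kc * (t - t0) := mul_nonneg hKc0 (by linarith [htt.1])
    rcases eq_or_lt_of_le (mem_closedBall.1 hxx) with hb | hb
    · left
      rw [hval, ← dist_eq_norm, hb]
      refine le_trans ?_ (hpos _ hD)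
      unfold para
      nlinarith [sq_nonneg ‖x - y0‖, htt.2]
    rcases eq_or_lt_of_le htt.1 with ht0 | ht0
    · left
      rw [hval, ← ht0]
      have := a7 x hD.1 t0 (by linarith) (le_refl _)
      nlinarith [sq_nonneg ‖x - x0‖]
    right
    refine ⟨?_, ht0, _, _, _, _, ?_, ?_, quadF_lowExp _ _ _ _ (le_refl 0) _ _ _ _ _⟩
    · exact interior_maximal ball_subset_closedBall isOpen_ball hb
    · norm_num
    · simp only [Real.sqrt_zero, zero_smul, norm_zero]
      rw [hKc]; linarith
  · rw [mem_closedBall, dist_eq_norm]; linarith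

lemma contact_grad (hG : 0 ≤ G)
    (hQ : QS lam G u (ball 0 1 ×ˢ Ioo 0 1)) (hu : ContinuousOn u (ball 0 1 ×ˢ Ioo 0 1))
    {y0 y1 : Eucl n} {h0 h1 : ℝ} {x0 x1 : Eucl n} {t0 t1 ρ A N H C1 : ℝ}
    (c0 : Contact u y0 h0 x0 t0) (c1 : Contact u y1 h1 x1 t1) (ht : t0 ≤ t1) (hρ0 : 0 < ρ)
    (hN : 0 < N) (hA : 0 < A) (hNρ : N * ρ ≤ 1/16)
    (hAN : 8 + 32 * G + (25 * G + 25/2) * A / N ^ 2 < lam * A)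
    (hH : 25/4 * A ≤ H) (hHC : C1 ≤ H) (hH0 : 0 < H) (hx : ‖x1 - x0‖ ≤ ρ)
    (hdrop : -(C1 * ρ ^ 2) ≤ ell y0 y1 h0 h1 x1) :
    ‖(32:ℝ) • (y1 - y0)‖ ≤ H * ρ := by
  obtain ⟨a1, a2, a3, a4, a5, a6, a7⟩ := c0
  obtain ⟨b1, b2, b3, b4, b5, b6, b7⟩ := c1
  by_contra hcon
  push Not at hcon
  set p := (32:ℝ) • (y1 - y0) with hp
  have hp0 : 0 < ‖p‖ := lt_trans (by positivity) hcon
  set e := (‖p‖)⁻¹ • p with he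
  have hen : ‖e‖ = 1 := by
    rw [he, norm_smul, norm_inv, norm_norm]; field_simp
  have hpe : ∀ w : Eucl n, ⟪p, w⟫ = ‖p‖ * ⟪e, w⟫ := by
    intro w
    have h := real_inner_smul_left p w (‖p‖)⁻¹
    rw [he, h]; field_simp
  have hl0 : -(2 * ρ * ‖p‖) ≤ ell y0 y1 h0 h1 x0 := by
    rw [ell_affine y0 y1 h0 h1 x0 x1] at hdrop
    have h1 : ⟪p, x1 - x0⟫ ≤ ‖p‖ * ρ :=
      (real_inner_le_norm _ _).trans (by gcongr)
    have h2 : C1 * ρ ^ 2 ≤ ρ * ‖p‖ := by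
      calc C1 * ρ ^ 2 ≤ H * ρ ^ 2 := by gcongr
        _ = ρ * (H * ρ) := by ring
        _ ≤ ρ * ‖p‖ := by gcongr
    linarith
  set k := 25/2 * A / N ^ 2 with hk
  have hk0 : 0 < k := by positivity
  set B := 25 * A / N ^ 2 with hB
  have hB0 : 0 < B := by positivity
  have hkN : k * (N ^ 2 * ρ ^ 2) = 25/2 * A * ρ ^ 2 := by rw [hk]; field_simp
  have hBN : B * (N ^ 2 * ρ ^ 2) = 25 * A * ρ ^ 2 := by rw [hB]; field_simp
  have hN2 : N ^ 2 * ρ ^ 2 ≤ 1/256 := by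
    have : (N * ρ) ^ 2 ≤ (1/16) ^ 2 := by gcongr
    rw [mul_pow] at this; linarith
  let K : Set (Eucl n) := closedBall x0 (N * ρ) ∩ {x | ⟪e, x - x0⟫ ∈ Icc (-ρ) (4 * ρ)}
  have hKc : IsCompact K := by
    apply (isCompact_closedBall _ _).inter_right
    exact isClosed_Icc.preimage (by fun_prop)
  have hKi : ball x0 (N * ρ) ∩ {x | ⟪e, x - x0⟫ ∈ Ioo (-ρ) (4 * ρ)} ⊆ interior K := by
    apply interior_maximal
    · exact inter_subset_inter ball_subset_closedBall (fun x hx => ⟨hx.1.le, hx.2.le⟩)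
    · exact isOpen_ball.inter (isOpen_Ioo.preimage (by fun_prop))
  have hsub : K ×ˢ Icc (t0 - N ^ 2 * ρ ^ 2) t0 ⊆ ball (0 : Eucl n) 1 ×ˢ Ioo (0:ℝ) 1 := by
    rintro ⟨x, t⟩ ⟨hx, ht⟩
    have hx := hx.1
    simp only [mem_closedBall, dist_eq_norm] at hx
    refine ⟨?_, by simp only; linarith [ht.1], by simp only; linarith [ht.2]⟩
    simp only [mem_ball, dist_zero_right]
    have : ‖x‖ ≤ ‖x - x0‖ + ‖x0‖ := by simpa using norm_add_le (x - x0) x0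
    linarith
  have main := comparison (φ := quadF (h0 - k * t0) (8 + k) A ρ B y0 e x0) hG hQ
    hKc hsub (hu.mono hsub) (quadF_continuous _ _ _ _ _ _ _ _).continuousOn
    ?_ x0 ?_ t0 ⟨by linarith [show 0 ≤ N ^ 2 * ρ ^ 2 by positivity], le_refl _⟩
  · rw [a6] at main
    simp only [quadF, sub_self, inner_zero_right, norm_zero, para] at main
    have : 0 < A * ρ ^ 2 := by positivity
    linarith
  · intro x hxx t htt
    have hD := hsub (show (x, t) ∈ _ from ⟨hxx, htt⟩)
    obtain ⟨hx1, hx2, hx3⟩ := hxx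
    set ξ := ⟪e, x - x0⟫ with hξ
    have hval : quadF (h0 - k * t0) (8 + k) A ρ B y0 e x0 (x, t) =
        para y0 h0 x t + k * (t - t0) + (1/2) * A * (ξ + ρ) ^ 2 - B / 2 * ‖x - x0‖ ^ 2 := by
      simp only [quadF, para]; ring
    have hu0 := a7 x hD.1 t hD.2.1 htt.2
    have hu1 := b7 x hD.1 t hD.2.1 (htt.2.trans ht)
    have hkt : k * (t - t0) ≤ 0 := mul_nonpos_of_nonneg_of_nonpos hk0.le (by linarith [htt.2])
    have hBx : 0 ≤ B / 2 * ‖x - x0‖ ^ 2 := by positivity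
    have hsq : (1/2) * A * (ξ + ρ) ^ 2 ≤ 25/2 * A * ρ ^ 2 := by
      have : (ξ + ρ) ^ 2 ≤ (5 * ρ) ^ 2 := by
        apply pow_le_pow_left₀ <;> linarith
      nlinarith
    rcases eq_or_lt_of_le hx2 with h | h2
    · left
      rw [hval, ← h]
      have : -ρ + ρ = 0 := by ring
      rw [this]; linarith
    rcases eq_or_lt_of_le hx3 with h | h3
    · left
      rw [hval]
      rw [para_ell y0 y1 h0 h1, ell_affine y0 y1 h0 h1 x0 x, hpe, ← hξ, h] at hu1
      have h5 : H * ρ * ρ ≤ ‖p‖ * ρ := by gcongr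
      have h6 : 25/4 * A * (ρ * ρ) ≤ H * (ρ * ρ) := by gcongr
      linarith
    rcases eq_or_lt_of_le (mem_closedBall.1 hx1) with h | h4
    · left
      rw [dist_eq_norm] at h
      rw [hval, h, mul_pow]
      linarith
    rcases eq_or_lt_of_le htt.1 with h | h5
    · left
      rw [hval]
      have : k * (t - t0) = -(25/2 * A * ρ ^ 2) := by rw [← hkN, ← h]; ring
      linarith
    right
    refine ⟨hKi ⟨h4, h2, h3⟩, h5, _, _, _, _, ?_, ?_, quadF_lowExp _ _ _ _ hA.le _ _ _ _ _⟩
    · positivity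
    · rw [norm_smul, hen, Real.norm_of_nonneg (by positivity), mul_one, Real.sq_sqrt hA.le]
      have : 8 + k + G * (32 + B) = 8 + 32 * G + (25 * G + 25/2) * A / N ^ 2 := by
        rw [hk, hB]; ring
      linarith
  · refine ⟨mem_closedBall_self (by positivity), ?_⟩
    simp only [mem_setOf_eq, sub_self, inner_zero_right]
    constructor <;> linarith

lemma ell_swap (y0 y1 : Eucl n) (h0 h1 : ℝ) (x : Eucl n) :
    ell y1 y0 h1 h0 x = - ell y0 y1 h0 h1 x := by
  unfold ell; ring

end

lemma contact_pair {lam G : ℝ} (hlam : 0 < lam) (hG : 0 ≤ G) :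
    ∃ C ρ0 : ℝ, 0 < C ∧ 0 < ρ0 ∧ ∀ {n : ℕ} {u : SpaceTime n → ℝ},
    QS lam G u (ball 0 1 ×ˢ Ioo 0 1) → ContinuousOn u (ball 0 1 ×ˢ Ioo 0 1) →
    (∀ P ∈ (ball (0 : Eucl n) 1 ×ˢ Ioo (0:ℝ) 1), 0 ≤ u P) →
    ∀ {y0 y1 : Eucl n} {h0 h1 : ℝ} {x0 x1 : Eucl n} {t0 t1 ρ : ℝ},
    Contact u y0 h0 x0 t0 → Contact u y1 h1 x1 t1 → 0 < ρ → ρ ≤ ρ0 →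
    ‖x1 - x0‖ ≤ ρ → |t1 - t0| ≤ ρ ^ 2 →
    ‖y1 - y0‖ ≤ C * ρ ∧ |ell y0 y1 h0 h1 x0| ≤ C * ρ ^ 2 := by
  set A := 2 * (9 + 32 * G) / lam with hA
  set C1 := 1033 + 2080 * G with hC1
  set N := Real.sqrt (2 * (25 * G + 25/2) / lam) with hNdef
  have hNs : N ^ 2 = 2 * (25 * G + 25/2) / lam := Real.sq_sqrt (by positivity)
  have hN : 0 < N := Real.sqrt_pos.2 (by positivity)
  have hA0 : 0 < A := by positivity
  set H := 25/4 * A + C1 with hH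
  have hC10 : 0 < C1 := by positivity
  have hH0 : 0 < H := by positivity
  have hAN : 8 + 32 * G + (25 * G + 25/2) * A / N ^ 2 < lam * A := by
    have e1 : (25 * G + 25/2) * A / N ^ 2 = 9 + 32 * G := by
      rw [hNs, hA]; field_simp
    have e2 : lam * A = 2 * (9 + 32 * G) := by rw [hA]; field_simp
    rw [e1, e2]; linarith
  have hHA : 25/4 * A ≤ H := by linarith
  have hHC : C1 ≤ H := by linarith
  refine ⟨C1 + 2 * H, min (1/16) (1 / (16 * N)), by positivity, by positivity, ?_⟩
  intro n u hQ hu hpos y0 y1 h0 h1 x0 x1 t0 t1 ρ c0 c1 hρ hρ0 hx ht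
  have hρ1 : ρ ≤ 1/16 := hρ0.trans (min_le_left _ _)
  have hρ2 : N * ρ ≤ 1/16 := by
    have : ρ ≤ 1 / (16 * N) := hρ0.trans (min_le_right _ _)
    calc N * ρ ≤ N * (1 / (16 * N)) := by gcongr
      _ = 1/16 := by field_simp
  -- ordered version
  have ord : ∀ {y0 y1 : Eucl n} {h0 h1 : ℝ} {x0 x1 : Eucl n} {t0 t1 : ℝ},
    Contact u y0 h0 x0 t0 → Contact u y1 h1 x1 t1 → t0 ≤ t1 →
    ‖x1 - x0‖ ≤ ρ → t1 - t0 ≤ ρ ^ 2 →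
    ‖(32:ℝ) • (y1 - y0)‖ ≤ H * ρ ∧ -((C1 + H) * ρ ^ 2) ≤ ell y0 y1 h0 h1 x0 ∧
      ell y0 y1 h0 h1 x0 ≤ 0 := by
    intro y0 y1 h0 h1 x0 x1 t0 t1 c0 c1 h01 hx ht
    have h1 := contact_drop hG hQ hu hpos c0 c1 h01 hρ1 hx ht
    have h2 := contact_grad hG hQ hu c0 c1 h01 hρ hN hA0 hρ2 hAN hHA hHC hH0 hx h1
    refine ⟨h2, ?_, ?_⟩
    · rw [ell_affine y0 y1 _ _ x0 x1] at h1
      have h3 : ⟪(32:ℝ) • (y1 - y0), x1 - x0⟫ ≤ (H * ρ) * ρ :=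
        (real_inner_le_norm _ _).trans (by gcongr)
      linarith
    · obtain ⟨a1, a2, a3, a4, a5, a6, a7⟩ := c0
      obtain ⟨b1, b2, b3, b4, b5, b6, b7⟩ := c1
      have := b7 x0 (by rw [mem_ball, dist_zero_right]; linarith) t0 (by linarith) h01
      rw [a6, para_ell y0 y1 h0 _] at this
      linarith
  have hs0 : 0 ≤ ρ ^ 2 := by positivity
  have nb : ‖(32:ℝ) • (y1 - y0)‖ ≤ H * ρ → ‖y1 - y0‖ ≤ (C1 + 2 * H) * ρ := by
    intro h
    rw [norm_smul, Real.norm_of_nonneg (by norm_num)] at h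
    have : 0 ≤ ‖y1 - y0‖ := norm_nonneg _
    have : 0 < C1 * ρ := by positivity
    have : 0 < H * ρ := by positivity
    linarith
  have hp1 : 0 ≤ H * ρ ^ 2 := by positivity
  have hp2 : 0 ≤ C1 * ρ ^ 2 := by positivity
  rcases le_total t0 t1 with h01 | h01
  · obtain ⟨q1, q2, q3⟩ := ord c0 c1 h01 hx ((le_abs_self _).trans ht)
    refine ⟨nb q1, ?_⟩
    rw [abs_le]; constructor <;> linarith
  · obtain ⟨q1, q2, q3⟩ := ord c1 c0 h01 (by rw [norm_sub_rev]; exact hx)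
      (by have := neg_abs_le (t1 - t0); linarith)
    have q1' : ‖(32:ℝ) • (y1 - y0)‖ ≤ H * ρ := by
      rw [← neg_sub, smul_neg, norm_neg]; exact q1
    refine ⟨nb q1', ?_⟩
    rw [ell_swap] at q2 q3
    rw [ell_affine y0 y1 _ _ x0 x1] at q2 q3
    have h3 : |⟪(32:ℝ) • (y1 - y0), x1 - x0⟫| ≤ (H * ρ) * ρ :=
      (abs_real_inner_le_norm _ _).trans (by gcongr)
    rw [abs_le] at h3 ⊢
    constructor <;> linarith

lemma first_contact {n : ℕ} {u : SpaceTime n → ℝ}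
    (hu : ContinuousOn u (ball 0 1 ×ˢ Ioo 0 1))
    (hpos : ∀ P ∈ (ball (0 : Eucl n) 1 ×ˢ Ioo (0:ℝ) 1), 0 < u P)
    {xs y : Eucl n} {h : ℝ} (hxs : ‖xs‖ ≤ 1/4) (hus : u (xs, 1/2) < 1) (hy : ‖xs - y‖ ≤ 1/8)
    (hh1 : -1 ≤ h) (hh2 : h ≤ -1/2) : ∃ x t, Contact u y h x t := by
  set K0 : Set (SpaceTime n) := closedBall 0 (7/8) ×ˢ Icc (1/16) (1/2) with hK0
  have hK0c : IsCompact K0 := (isCompact_closedBall _ _).prod isCompact_Icc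
  have hsub : K0 ⊆ ball (0 : Eucl n) 1 ×ˢ Ioo (0:ℝ) 1 := by
    rintro ⟨x, t⟩ ⟨hx, ht⟩
    simp only [mem_closedBall, dist_zero_right] at hx
    refine ⟨?_, by simp only; linarith [ht.1], by simp only; linarith [ht.2]⟩
    simp only [mem_ball, dist_zero_right]; linarith
  have hpc : Continuous (fun P : SpaceTime n => para y h P.1 P.2) := by
    unfold para; fun_prop
  have hKc : IsCompact {P | P ∈ K0 ∧ u P ≤ para y h P.1 P.2} :=
    hK0c.of_isClosed_subset (hK0c.isClosed.isClosed_le (hu.mono hsub) hpc.continuousOn)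
      (fun P hP => hP.1)
  have hne : ({P | P ∈ K0 ∧ u P ≤ para y h P.1 P.2}).Nonempty := by
    refine ⟨(xs, 1/2), ⟨?_, by norm_num, by norm_num⟩, ?_⟩
    · simp only [mem_closedBall, dist_zero_right]; linarith
    · have : ‖xs - y‖ ^ 2 ≤ (1/8) ^ 2 := by gcongr
      unfold para
      simp only
      linarith
  obtain ⟨⟨x, t⟩, ⟨⟨hx, ht⟩, hxt⟩, hmin⟩ := hKc.exists_isMinOn hne continuous_snd.continuousOn
  simp only at hx ht hxt
  have key : ∀ x' ∈ ball (0 : Eucl n) 1, ∀ t', 0 < t' → t' < t → para y h x' t' ≤ u (x', t') := by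
    intro x' hx' t' ht0 htt
    by_contra hc
    push Not at hc
    have h1 : 0 < u (x', t') := hpos _ ⟨hx', ht0, by simp only; linarith [ht.2]⟩
    have h2 : 0 < h + 8 * t' - 16 * ‖x' - y‖ ^ 2 := h1.trans hc
    have h3 : ‖x' - y‖ < 1/2 := by
      have : ‖x' - y‖ ^ 2 < (1/2) ^ 2 := by linarith [ht.2]
      exact lt_of_pow_lt_pow_left₀ 2 (by norm_num) this
    have h4 : ‖x'‖ ≤ 7/8 := by
      have e : x' = (x' - y) - (xs - y) + xs := by module
      have := norm_add_le ((x' - y) - (xs - y)) xs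
      have := norm_sub_le (x' - y) (xs - y)
      rw [e]; linarith
    have h5 : (x', t') ∈ {P | P ∈ K0 ∧ u P ≤ para y h P.1 P.2} := by
      refine ⟨⟨by simpa using h4, ?_, ?_⟩, hc.le⟩
      · simp only; nlinarith [sq_nonneg ‖x' - y‖]
      · simp only; linarith [ht.2]
    have := hmin h5
    simp only [mem_ofPred_eq] at this
    linarith
  have key2 : ∀ x' ∈ ball (0 : Eucl n) 1, ∀ t', 0 < t' → t' ≤ t → para y h x' t' ≤ u (x', t') := by
    intro x' hx' t' ht0 htt
    rcases eq_or_lt_of_le htt with h | h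
    · subst h
      have hD : (x', t') ∈ ball (0 : Eucl n) 1 ×ˢ Ioo (0:ℝ) 1 :=
        ⟨hx', ht0, by simp only; linarith [ht.2]⟩
      have c1 : ContinuousAt u (x', t') :=
        hu.continuousAt ((isOpen_ball.prod isOpen_Ioo).mem_nhds hD)
      have c2 : Filter.Tendsto (fun s : ℝ => u (x', s)) (nhdsWithin t' (Iio t'))
          (nhds (u (x', t'))) := by
        have : ContinuousAt (fun s : ℝ => u (x', s)) t' :=
          ContinuousAt.comp (f := fun s : ℝ => (x', s)) c1 (by fun_prop)
        exact this.tendsto.mono_left nhdsWithin_le_nhds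
      have c3 : Filter.Tendsto (fun s : ℝ => para y h x' s) (nhdsWithin t' (Iio t'))
          (nhds (para y h x' t')) := by
        have : Continuous (fun s : ℝ => para y h x' s) := by unfold para; fun_prop
        exact (this.tendsto t').mono_left nhdsWithin_le_nhds
      refine le_of_tendsto_of_tendsto c3 c2 ?_
      filter_upwards [Ioo_mem_nhdsLT ht0] with s hs
      exact key x' hx' s hs.1 hs.2
    · exact key x' hx' t' ht0 h
  have hx7 : ‖x‖ ≤ 7/8 := by simpa using hx
  refine ⟨x, t, hx7, ht.1, ht.2, hh1, hh2, ?_, key2⟩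
  refine le_antisymm hxt (key2 x (by rw [mem_ball, dist_zero_right]; linarith) t
    (by linarith [ht.1]) le_rfl)

def tile {n : ℕ} (s : ℝ) (k : (Fin n → ℤ) × ℤ) : Set (SpaceTime n) :=
  {P | (∀ i, ⌊P.1 i / s⌋ = k.1 i) ∧ ⌊P.2 / s ^ 2⌋ = k.2}

lemma tile_eq {n : ℕ} {s : ℝ} (hs : 0 < s) (k : (Fin n → ℤ) × ℤ) :
    tile s k = (WithLp.ofLp ⁻¹' (Set.pi univ fun i => Ico (k.1 i * s) ((k.1 i + 1) * s)) :
      Set (Eucl n)) ×ˢ Ico (k.2 * s ^ 2) ((k.2 + 1) * s ^ 2) := by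
  ext P
  have hs2 : 0 < s ^ 2 := by positivity
  simp only [tile, mem_ofPred_eq, Int.floor_eq_iff, le_div_iff₀ hs, div_lt_iff₀ hs,
    le_div_iff₀ hs2, div_lt_iff₀ hs2, mem_prod, mem_preimage, mem_pi, mem_univ, true_imp_iff,
    mem_Ico]

lemma tile_measurable {n : ℕ} {s : ℝ} (hs : 0 < s) (k : (Fin n → ℤ) × ℤ) :
    MeasurableSet (tile s k) := by
  rw [tile_eq hs]
  refine MeasurableSet.prod ?_ measurableSet_Ico
  exact (PiLp.volume_preserving_ofLp (Fin n)).measurable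
    (MeasurableSet.univ_pi fun i => measurableSet_Ico)

lemma tile_volume {n : ℕ} {s : ℝ} (hs : 0 < s) (k : (Fin n → ℤ) × ℤ) :
    volume (tile s k) = ENNReal.ofReal (s ^ (n + 2)) := by
  rw [tile_eq hs, Measure.volume_eq_prod, Measure.prod_prod,
    (PiLp.volume_preserving_ofLp (Fin n)).measure_preimage
      (MeasurableSet.univ_pi fun i => measurableSet_Ico).nullMeasurableSet,
    Real.volume_pi_Ico, Real.volume_Ico]
  have : ∀ i, ENNReal.ofReal ((k.1 i + 1) * s - k.1 i * s) = ENNReal.ofReal s := by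
    intro i; congr 1; ring
  simp only [this, Finset.prod_const, Finset.card_univ, Fintype.card_fin]
  have e : ((k.2 : ℝ) + 1) * s ^ 2 - k.2 * s ^ 2 = s ^ 2 := by ring
  rw [e, ← ENNReal.ofReal_pow hs.le, ← ENNReal.ofReal_mul (by positivity), ← pow_add]

lemma tile_diam {n : ℕ} {s : ℝ} (hs : 0 < s) {k : (Fin n → ℤ) × ℤ} {P Q : SpaceTime n}
    (hP : P ∈ tile s k) (hQ : Q ∈ tile s k) :
    ‖P.1 - Q.1‖ ≤ (n + 1) * s ∧ |P.2 - Q.2| ≤ s ^ 2 := by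
  rw [tile_eq hs] at hP hQ
  obtain ⟨hP1, hP2⟩ := hP
  obtain ⟨hQ1, hQ2⟩ := hQ
  simp only [mem_preimage, mem_pi, mem_univ, true_imp_iff, mem_Ico] at hP1 hQ1 hP2 hQ2
  constructor
  · have h1 : ‖P.1 - Q.1‖ ^ 2 ≤ ((n + 1) * s) ^ 2 := by
      rw [EuclideanSpace.norm_sq_eq]
      calc ∑ i, ‖(P.1 - Q.1) i‖ ^ 2 ≤ ∑ i : Fin n, s ^ 2 := by
            apply Finset.sum_le_sum
            intro i _
            have : |P.1 i - Q.1 i| ≤ s := by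
              have := hP1 i; have := hQ1 i
              rw [abs_le]; constructor <;> linarith
            simp only [PiLp.sub_apply, Real.norm_eq_abs]
            gcongr
        _ = n * s ^ 2 := by simp
        _ ≤ ((n + 1) * s) ^ 2 := by
            have h0 : (0:ℝ) ≤ n := Nat.cast_nonneg n
            have : (n:ℝ) ≤ (n + 1) ^ 2 := by nlinarith
            rw [mul_pow]; gcongr
    exact le_of_sq_le_sq h1 (by positivity)
  · rw [abs_le]; constructor <;> linarith

lemma slab_volume {n : ℕ} (y0 x0 : Eucl n) (h0 : ℝ) {a b : ℝ} (ha : 0 ≤ a) (hb : 0 ≤ b) :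
    volume {θ : SpaceTime n | ‖θ.1 - y0‖ ≤ a ∧ |ell y0 θ.1 h0 θ.2 x0| ≤ b} ≤
      ENNReal.ofReal (2 * b * a ^ n) * volume (ball (0 : Eucl n) 1) := by
  have hm : MeasurableSet {θ : SpaceTime n | ‖θ.1 - y0‖ ≤ a ∧ |ell y0 θ.1 h0 θ.2 x0| ≤ b} := by
    apply IsClosed.measurableSet
    have c1 : Continuous fun θ : SpaceTime n => ‖θ.1 - y0‖ := by fun_prop
    have c2 : Continuous fun θ : SpaceTime n => |ell y0 θ.1 h0 θ.2 x0| := by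
      unfold ell; fun_prop
    exact (isClosed_le c1 continuous_const).inter (isClosed_le c2 continuous_const)
  rw [Measure.volume_eq_prod, Measure.prod_apply hm]
  calc _ ≤ ∫⁻ y, (closedBall y0 a).indicator (fun _ => ENNReal.ofReal (2 * b)) y := by
        apply lintegral_mono
        intro y
        by_cases hy : y ∈ closedBall y0 a
        · rw [indicator_of_mem hy]
          calc _ ≤ volume (closedBall (h0 + 16 * (‖x0 - y‖ ^ 2 - ‖x0 - y0‖ ^ 2)) b) := by
                apply measure_mono
                intro h hh
                have := hh.2
                unfold ell at this
                rw [mem_closedBall, Real.dist_eq]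
                convert this using 2
                ring
            _ = _ := Real.volume_closedBall _ _
        · rw [indicator_of_notMem hy]
          refine le_of_eq ?_
          convert measure_empty (μ := volume)
          ext h
          simp only [mem_preimage, mem_ofPred_eq, mem_empty_iff_false, iff_false]
          rw [mem_closedBall, dist_eq_norm] at hy
          exact fun hh => hy hh.1
    _ = ENNReal.ofReal (2 * b) * volume (closedBall y0 a) := by
        rw [lintegral_indicator measurableSet_closedBall, setLIntegral_const]
    _ = _ := by
        rw [Measure.addHaar_closedBall _ _ ha, ← mul_assoc, ← ENNReal.ofReal_mul (by positivity)]
        simp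

lemma growth_unit (n : ℕ) {lam G : ℝ} (hlam : 0 < lam) (hG : 0 ≤ G) :
    ∃ μ : ENNReal, 0 < μ ∧ ∀ u : SpaceTime n → ℝ,
    QS lam G u (ball 0 1 ×ˢ Ioo 0 1) → ContinuousOn u (ball 0 1 ×ˢ Ioo 0 1) →
    (∀ P ∈ (ball (0 : Eucl n) 1 ×ˢ Ioo (0:ℝ) 1), 0 < u P) →
    volume ((ball (0 : Eucl n) 1 ×ˢ Ioo (0:ℝ) 1) ∩ {P | u P ≤ 5}) < μ →
    ∀ xs : Eucl n, ‖xs‖ ≤ 1/4 → 1 ≤ u (xs, 1/2) := by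
  obtain ⟨C, ρ0, hC, hρ0, hpair⟩ := contact_pair hlam hG
  set κ : ℝ := 2 * (C * (n + 1) ^ 2) * (C * (n + 1)) ^ n with hκ
  have hκ0 : 0 < κ := by positivity
  set Kc : ENNReal := ENNReal.ofReal κ * volume (ball (0 : Eucl n) 1) with hKc
  have hb0 : volume (ball (0 : Eucl n) 1) ≠ 0 := (measure_ball_pos _ _ one_pos).ne'
  have hbt : volume (ball (0 : Eucl n) 1) ≠ ⊤ := measure_ball_lt_top.ne
  have hK0 : Kc ≠ 0 := mul_ne_zero (by simpa using hκ0) hb0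
  have hKt : Kc ≠ ⊤ := ENNReal.mul_ne_top ENNReal.ofReal_ne_top hbt
  set θ0 : ENNReal := ENNReal.ofReal ((1/8)^n) * volume (ball (0 : Eucl n) 1) * ENNReal.ofReal (1/2)
    with hθ0
  have hθp : 0 < θ0 := by
    apply ENNReal.mul_pos (mul_ne_zero _ hb0) <;> simp
  refine ⟨θ0 / Kc, ENNReal.div_pos hθp.ne' hKt, ?_⟩
  intro u hQ hu hpos hvol xs hxs
  by_contra hus
  push Not at hus
  apply absurd hvol
  rw [not_lt, ENNReal.div_le_iff hK0 hKt, mul_comm]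
  -- uniform continuity
  set K1 : Set (SpaceTime n) := closedBall 0 (15/16) ×ˢ Icc (1/32) (3/4) with hK1
  have hK1c : IsCompact K1 := (isCompact_closedBall _ _).prod isCompact_Icc
  have hK1s : K1 ⊆ ball (0 : Eucl n) 1 ×ˢ Ioo (0:ℝ) 1 := by
    rintro ⟨x, t⟩ ⟨hx, ht⟩
    simp only [mem_closedBall, dist_zero_right] at hx
    refine ⟨?_, by simp only; linarith [ht.1], by simp only; linarith [ht.2]⟩
    simp only [mem_ball, dist_zero_right]; linarith
  obtain ⟨δ, hδ, huc⟩ := Metric.uniformContinuousOn_iff.1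
    (hK1c.uniformContinuousOn_of_continuous (hu.mono hK1s)) 1 one_pos
  set ρ := min (min (δ/2) (1/32)) ρ0 with hρdef
  have hρ : 0 < ρ := by positivity
  have hρδ : ρ < δ := ((min_le_left _ _).trans (min_le_left _ _)).trans_lt (by linarith)
  have hρ32 : ρ ≤ 1/32 := (min_le_left _ _).trans (min_le_right _ _)
  have hρρ : ρ ≤ ρ0 := min_le_right _ _
  set s := ρ / (n + 1) with hs
  have hs0 : 0 < s := by positivity
  have hsρ : (n + 1) * s = ρ := by rw [hs]; field_simp
  have hsl : s ≤ ρ := by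
    rw [hs]; apply div_le_self hρ.le; have : (0:ℝ) ≤ n := Nat.cast_nonneg n; linarith
  have hsl2 : s ^ 2 ≤ ρ ^ 2 := by gcongr
  let S : (Fin n → ℤ) × ℤ → Set (SpaceTime n) := fun k =>
    {θ | ∃ P ∈ tile s k, Contact u θ.1 θ.2 P.1 P.2}
  have hS : ∀ k, volume (S k) ≤ Kc * volume (tile s k) := by
    intro k
    rcases (S k).eq_empty_or_nonempty with he | ⟨⟨y0, h0⟩, P0, hP0, c0⟩
    · rw [he]; simp
    · calc volume (S k) ≤ volume {θ : SpaceTime n | ‖θ.1 - y0‖ ≤ C * ρ ∧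
            |ell y0 θ.1 h0 θ.2 P0.1| ≤ C * ρ ^ 2} := by
            apply measure_mono
            rintro ⟨y, h⟩ ⟨P, hP, c⟩
            have hd := tile_diam hs0 hP hP0
            exact hpair hQ hu (fun P hP => (hpos P hP).le) c0 c hρ hρρ (by rw [← hsρ]; exact hd.1)
              (hd.2.trans hsl2)
        _ ≤ _ := slab_volume y0 P0.1 h0 (by positivity) (by positivity)
        _ = _ := by
            rw [tile_volume hs0, hKc, mul_right_comm (ENNReal.ofReal κ), ← ENNReal.ofReal_mul (by positivity)]
            congr 2
            rw [hκ, ← hsρ]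
            simp only [mul_pow, pow_add]; ring
  let J : Set ((Fin n → ℤ) × ℤ) := {k | (S k).Nonempty}
  have hcov : ball xs (1/8) ×ˢ Ioo (-1:ℝ) (-1/2) ⊆ ⋃ k ∈ J, S k := by
    rintro ⟨y, h⟩ ⟨hy, hh⟩
    have hy' : ‖xs - y‖ ≤ 1/8 := by
      rw [mem_ball, dist_eq_norm, norm_sub_rev] at hy; exact hy.le
    obtain ⟨x, t, hc⟩ := first_contact hu hpos hxs hus hy' hh.1.le hh.2.le
    simp only [mem_iUnion]
    have hm : (y, h) ∈ S (fun i => ⌊x i / s⌋, ⌊t / s ^ 2⌋) := ⟨(x, t), ⟨fun _ => rfl, rfl⟩, hc⟩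
    exact ⟨_, ⟨_, hm⟩, hm⟩
  have htl : (⋃ k ∈ J, tile s k) ⊆ (ball (0 : Eucl n) 1 ×ˢ Ioo (0:ℝ) 1) ∩ {P | u P ≤ 5} := by
    intro P hP
    simp only [mem_iUnion] at hP
    obtain ⟨k, ⟨⟨y, h⟩, P0, hP0, c0⟩, hPk⟩ := hP
    have hd := tile_diam hs0 hPk hP0
    rw [hsρ] at hd
    have hρ2 : s ^ 2 ≤ ρ := hsl2.trans (by nlinarith)
    obtain ⟨a1, a2, a3, a4, a5, a6, a7⟩ := c0
    have ha := abs_le.1 (hd.2.trans hρ2)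
    have hn : ‖P.1‖ ≤ ‖P.1 - P0.1‖ + ‖P0.1‖ := by simpa using norm_add_le (P.1 - P0.1) P0.1
    have m1 : P ∈ K1 := by
      refine ⟨?_, by linarith, by linarith⟩
      simp only [mem_closedBall, dist_zero_right]; linarith [hd.1]
    have m0 : P0 ∈ K1 := by
      refine ⟨?_, by linarith, by linarith⟩
      simp only [mem_closedBall, dist_zero_right]; linarith
    refine ⟨hK1s m1, ?_⟩
    have hdist : dist P P0 < δ := by
      rw [Prod.dist_eq, max_lt_iff, dist_eq_norm, Real.dist_eq]
      exact ⟨hd.1.trans_lt hρδ, (hd.2.trans hρ2).trans_lt hρδ⟩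
    have := huc P m1 P0 m0 hdist
    rw [Real.dist_eq, abs_lt] at this
    have hv : u P0 ≤ 4 := by
      have e : u P0 = para y h P0.1 P0.2 := a6
      rw [e]; unfold para
      have : 0 ≤ ‖P0.1 - y‖ ^ 2 := by positivity
      linarith
    simp only [mem_ofPred_eq]; linarith
  calc θ0 = volume (ball xs (1/8) ×ˢ Ioo (-1:ℝ) (-1/2)) := by
        rw [Measure.volume_eq_prod, Measure.prod_prod, Measure.addHaar_ball_of_pos _ _ (by norm_num),
          Real.volume_Ioo, hθ0]
        rw [finrank_euclideanSpace_fin]; norm_num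
    _ ≤ volume (⋃ k ∈ J, S k) := measure_mono hcov
    _ ≤ ∑' k : J, volume (S k) := measure_biUnion_le _ (to_countable J) _
    _ ≤ ∑' k : J, Kc * volume (tile s (k : (Fin n → ℤ) × ℤ)) := ENNReal.tsum_le_tsum fun k => hS k
    _ = Kc * volume (⋃ k ∈ J, tile s k) := by
        rw [ENNReal.tsum_mul_left, measure_biUnion (to_countable J) _ (fun k _ => tile_measurable hs0 k)]
        intro k _ k' _ hkk
        rw [Function.onFun, Set.disjoint_left]
        intro P hP hP'
        apply hkk
        ext i
        · rw [← hP.1 i, ← hP'.1 i]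
        · rw [← hP.2, ← hP'.2]
    _ ≤ _ := by gcongr

/-- parabolic scaling map -/
noncomputable def Phi {n : ℕ} (x0 : Eucl n) (t0 r : ℝ) (P : SpaceTime n) : SpaceTime n :=
  (x0 + r • P.1, t0 + r ^ 2 * P.2)

lemma Phi_continuous {n : ℕ} (x0 : Eucl n) (t0 r : ℝ) : Continuous (Phi x0 t0 r) := by
  unfold Phi; fun_prop

lemma Phi_volume {n : ℕ} (x0 : Eucl n) (t0 : ℝ) {r : ℝ} (hr : 0 < r) {S : Set (SpaceTime n)}
    (hS : MeasurableSet S) :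
    volume (Phi x0 t0 r ⁻¹' S) = ENNReal.ofReal ((r ^ (n + 2))⁻¹) * volume S := by
  rw [← Measure.map_apply (Phi_continuous x0 t0 r).measurable hS]
  have e : Phi x0 t0 r = Prod.map (fun x : Eucl n => x0 + r • x) (fun t : ℝ => t0 + r ^ 2 * t) := rfl
  have e1 : Measure.map (fun x : Eucl n => x0 + r • x) volume =
      ENNReal.ofReal ((r ^ n)⁻¹) • volume := by
    have : (fun x : Eucl n => x0 + r • x) = (fun x => x0 + x) ∘ (fun x => r • x) := rfl
    rw [this, ← Measure.map_map (by fun_prop) (by fun_prop), Measure.map_addHaar_smul _ hr.ne',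
      Measure.map_smul, map_add_left_eq_self, finrank_euclideanSpace_fin, abs_of_pos (by positivity)]
  have e2 : Measure.map (fun t : ℝ => t0 + r ^ 2 * t) volume =
      ENNReal.ofReal ((r ^ 2)⁻¹) • volume := by
    have : (fun t : ℝ => t0 + r ^ 2 * t) = (fun x => t0 + x) ∘ (fun x => r ^ 2 • x) := rfl
    rw [this, ← Measure.map_map (by fun_prop) (by fun_prop),
      Measure.map_addHaar_smul _ (by positivity),
      Measure.map_smul, map_add_left_eq_self, Module.finrank_self, pow_one,
      abs_of_pos (by positivity)]
  rw [e, Measure.volume_eq_prod, ← Measure.map_prod_map _ _ (by fun_prop) (by fun_prop), e1, e2,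
    Measure.prod_smul_left, Measure.prod_smul_right, smul_smul, Measure.smul_apply, smul_eq_mul,
    ← ENNReal.ofReal_mul (by positivity), ← mul_inv, ← pow_add]

lemma QS.scale {n : ℕ} {lam G : ℝ} {u : SpaceTime n → ℝ} {D D' : Set (SpaceTime n)}
    (hQ : QS lam G u D) (x0 : Eucl n) (t0 : ℝ) {r m : ℝ} (hr : 0 < r) (hm : 0 < m)
    (hD : ∀ P ∈ D', Phi x0 t0 r P ∈ D) : QS lam G (fun P => u (Phi x0 t0 r P) / m) D' := by
  intro x1 t1 b B ρ p z hρ hB hsub htouch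
  have inv : ∀ X T, (X, T) ∈ cylE (x0 + r • x1) (t0 + r ^ 2 * t1) (r * ρ) →
      ∃ x t, (x, t) ∈ cylE x1 t1 ρ ∧ X = x0 + r • x ∧ T = t0 + r ^ 2 * t := by
    rintro X T ⟨hX, hT⟩
    have eX : X = x0 + r • (r⁻¹ • (X - x0)) := by
      rw [smul_smul, mul_inv_cancel₀ hr.ne']; module
    have eT : T = t0 + r ^ 2 * ((T - t0) / r ^ 2) := by field_simp; ring
    refine ⟨r⁻¹ • (X - x0), (T - t0) / r ^ 2, ⟨?_, ?_⟩, eX, eT⟩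
    · simp only [mem_ball, dist_eq_norm] at hX ⊢
      rw [eX] at hX
      have : x0 + r • (r⁻¹ • (X - x0)) - (x0 + r • x1) = r • (r⁻¹ • (X - x0) - x1) := by module
      rw [this, norm_smul, Real.norm_of_nonneg hr.le] at hX
      exact lt_of_mul_lt_mul_left hX hr.le
    · simp only [mem_Ioc] at hT ⊢
      rw [eT] at hT
      set τ := (T - t0) / r ^ 2
      have h2 : 0 < r ^ 2 := by positivity
      constructor
      · have : r ^ 2 * (t1 - ρ ^ 2) < r ^ 2 * τ := by nlinarith [hT.1]
        exact lt_of_mul_lt_mul_left this h2.le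
      · have : r ^ 2 * τ ≤ r ^ 2 * t1 := by linarith [hT.2]
        exact le_of_mul_le_mul_left this h2
  have h := hQ (x0 + r • x1) (t0 + r ^ 2 * t1) (m * b / r ^ 2) (m * B / r ^ 2) (r * ρ)
    ((m / r) • p) ((Real.sqrt m / r) • z) (by positivity) (by positivity) ?_ ?_
  · rw [norm_smul, Real.norm_of_nonneg (by positivity), mul_pow, div_pow, Real.sq_sqrt hm.le] at h
    have e : lam * (m / r ^ 2 * ‖z‖ ^ 2) - G * (m * B / r ^ 2) =
      (m / r ^ 2) * (lam * ‖z‖ ^ 2 - G * B) := by ring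
    have e' : m * b / r ^ 2 = (m / r ^ 2) * b := by ring
    rw [e, e'] at h
    exact le_of_mul_le_mul_left h (by positivity)
  · rintro ⟨X, T⟩ hXT
    obtain ⟨x, t, hxt, rfl, rfl⟩ := inv X T hXT
    exact hD _ (hsub hxt)
  · intro X T hXT
    obtain ⟨x, t, hxt, rfl, rfl⟩ := inv X T hXT
    have h := htouch x t hxt
    simp only [Phi] at h
    have e1 : x0 + r • x - (x0 + r • x1) = r • (x - x1) := by module
    rw [e1, norm_smul, Real.norm_of_nonneg hr.le, real_inner_smul_left, real_inner_smul_left,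
      real_inner_smul_right, real_inner_smul_right]
    rw [le_div_iff₀ hm] at h
    refine le_trans (le_of_eq ?_) h
    have hs : Real.sqrt m ^ 2 = m := Real.sq_sqrt hm.le
    have e2 : (Real.sqrt m / r * (r * ⟪z, x - x1⟫)) ^ 2 = m * ⟪z, x - x1⟫ ^ 2 := by
      have : Real.sqrt m / r * (r * ⟪z, x - x1⟫) = Real.sqrt m * ⟪z, x - x1⟫ := by field_simp
      rw [this, mul_pow, hs]
    rw [e2]; field_simp; ring

def Qc {n : ℕ} (x : Eucl n) (t r : ℝ) : Set (SpaceTime n) := ball x r ×ˢ Ioo t (t + r ^ 2)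

lemma Qc_open {n : ℕ} (x : Eucl n) (t r : ℝ) : IsOpen (Qc x t r) := isOpen_ball.prod isOpen_Ioo

lemma Qc_volume_ne_top {n : ℕ} (x : Eucl n) (t r : ℝ) : volume (Qc x t r) ≠ ⊤ := by
  unfold Qc
  rw [Measure.volume_eq_prod, Measure.prod_prod]
  exact ENNReal.mul_ne_top measure_ball_lt_top.ne measure_Ioo_lt_top.ne

lemma Phi_mem_ball {n : ℕ} (x0 : Eucl n) (t0 : ℝ) {r : ℝ} (hr : 0 < r) (P : SpaceTime n) (a : ℝ) :
    (Phi x0 t0 r P).1 ∈ ball x0 (r * a) ↔ P.1 ∈ ball (0 : Eucl n) a := by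
  simp only [Phi, mem_ball, dist_eq_norm, add_sub_cancel_left, norm_smul, sub_zero,
    Real.norm_of_nonneg hr.le]
  exact mul_lt_mul_iff_right₀ hr

lemma Phi_mem_Ioo {n : ℕ} (x0 : Eucl n) (t0 : ℝ) {r : ℝ} (hr : 0 < r) (P : SpaceTime n) (a b : ℝ) :
    (Phi x0 t0 r P).2 ∈ Ioo (t0 + r ^ 2 * a) (t0 + r ^ 2 * b) ↔ P.2 ∈ Ioo a b := by
  simp only [Phi, mem_Ioo, add_lt_add_iff_left]
  rw [mul_lt_mul_iff_right₀ (by positivity), mul_lt_mul_iff_right₀ (by positivity)]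

lemma Qc_preimage {n : ℕ} (x : Eucl n) (t : ℝ) {r : ℝ} (hr : 0 < r) :
    Phi x t r ⁻¹' Qc x t r = ball (0 : Eucl n) 1 ×ˢ Ioo (0:ℝ) 1 := by
  ext P
  have h1 := Phi_mem_ball x t hr P 1
  have h2 := Phi_mem_Ioo x t hr P 0 1
  rw [mul_one] at h1
  rw [mul_one, mul_zero, add_zero] at h2
  rw [mem_preimage, Qc, mem_prod, mem_prod, h1, h2]

lemma open_superlevel {n : ℕ} {u : SpaceTime n → ℝ} {D : Set (SpaceTime n)} (hD : IsOpen D)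
    (hu : ContinuousOn u D) (a : ℝ) : IsOpen (D ∩ {P | a < u P}) :=
  hu.isOpen_inter_preimage hD isOpen_Ioi

lemma growth (n : ℕ) {lam G : ℝ} (hlam : 0 < lam) (hG : 0 ≤ G) :
    ∃ μ : ℝ, 0 < μ ∧ μ < 1 ∧ ∀ (u : SpaceTime n → ℝ) (D : Set (SpaceTime n)) (x : Eucl n) (t r m : ℝ),
    QS lam G u D → ContinuousOn u D → (∀ P ∈ D, 0 < u P) → 0 < r → 0 < m → Qc x t r ⊆ D →
    ENNReal.ofReal (1 - μ) * volume (Qc x t r) ≤ volume (Qc x t r ∩ {P | m * 5 < u P}) →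
    ∀ w : Eucl n, dist w x ≤ r / 4 → m ≤ u (w, t + r ^ 2 / 2) := by
  obtain ⟨μ0, hμ0, H⟩ := growth_unit n hlam hG
  have hV : volume (ball (0 : Eucl n) 1 ×ˢ Ioo (0:ℝ) 1) ≠ ⊤ := by
    have := Qc_volume_ne_top (0 : Eucl n) 0 1
    simpa [Qc] using this
  obtain ⟨c, hc, hcμ⟩ := ENNReal.exists_nnreal_pos_mul_lt hV hμ0.ne'
  refine ⟨min (c:ℝ) (1/2), by positivity, by
    exact (min_le_right _ _).trans_lt (by norm_num), ?_⟩
  intro u D x t r m hQ hu hpos hr hm hsub hdense w hw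
  have hphi : ∀ P ∈ (ball (0 : Eucl n) 1 ×ˢ Ioo (0:ℝ) 1), Phi x t r P ∈ D := by
    intro P hP
    rw [← Qc_preimage x t hr] at hP
    exact hsub hP
  have huQ := hu.mono hsub
  have hopen := open_superlevel (Qc_open x t r) huQ (m * 5)
  have hset : (ball (0 : Eucl n) 1 ×ˢ Ioo (0:ℝ) 1) ∩ {P | u (Phi x t r P) / m ≤ 5} =
      Phi x t r ⁻¹' (Qc x t r \ (Qc x t r ∩ {P | m * 5 < u P})) := by
    rw [← Qc_preimage x t hr]
    ext P
    simp only [mem_inter_iff, mem_preimage, mem_ofPred_eq, mem_sdiff, not_and, not_lt,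
      div_le_iff₀ hm]
    constructor
    · rintro ⟨a, b⟩; exact ⟨a, fun _ => by linarith⟩
    · rintro ⟨a, b⟩; exact ⟨a, by linarith [b a]⟩
  have h := H (fun P => u (Phi x t r P) / m) (hQ.scale x t hr hm hphi)
    ((hu.comp (Phi_continuous x t r).continuousOn hphi).div_const m)
    (fun P hP => div_pos (hpos _ (hphi P hP)) hm) ?_ (r⁻¹ • (w - x)) ?_
  · simp only [Phi] at h
    rw [smul_smul, mul_inv_cancel₀ hr.ne', one_smul, le_div_iff₀ hm, one_mul, add_sub_cancel] at h
    have e : r ^ 2 / 2 = r ^ 2 * (1 / 2) := by ring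
    rw [e]; exact h
  · rw [hset, Phi_volume x t hr ((Qc_open x t r).measurableSet.diff hopen.measurableSet)]
    refine lt_of_le_of_lt ?_ hcμ
    rw [← Qc_preimage x t hr, Phi_volume x t hr (Qc_open x t r).measurableSet, ← mul_assoc,
      mul_comm (c : ENNReal), mul_assoc]
    gcongr
    rw [measure_sdiff inter_subset_left hopen.nullMeasurableSet
      (ne_top_of_le_ne_top (Qc_volume_ne_top x t r) (measure_mono inter_subset_left))]
    rw [tsub_le_iff_right]
    calc volume (Qc x t r) = (ENNReal.ofReal (min (c:ℝ) (1/2)) + ENNReal.ofReal (1 - min (c:ℝ) (1/2))) *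
          volume (Qc x t r) := by
          rw [← ENNReal.ofReal_add (by positivity)]
          · simp
          · linarith [min_le_right (c:ℝ) (1/2)]
      _ ≤ _ := by
          rw [add_mul]
          gcongr
          rw [← ENNReal.ofReal_coe_nnreal]
          exact ENNReal.ofReal_le_ofReal (min_le_left _ _)
  · rw [norm_smul, norm_inv, Real.norm_of_nonneg hr.le, ← dist_eq_norm]
    rw [inv_mul_le_iff₀ hr]; linarith

lemma pick_scale {P : ℝ → Prop} {L Rk rs : ℝ} (hL : 1 < L) (hrs : 0 < rs) (hrs4 : rs ≤ 1/4)
    (hP : P rs) (hb : ∀ r, 0 < r → r ≤ 1/4 → P r → r ≤ Rk) (hLR : L * Rk ≤ 1/4) :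
    ∃ r, 0 < r ∧ r ≤ Rk ∧ P r ∧ ¬ P (L * r) := by
  by_contra hcon
  push Not at hcon
  have hall : ∀ j : ℕ, L ^ j * rs ≤ Rk ∧ P (L ^ j * rs) := by
    intro j
    induction j with
    | zero => simpa using ⟨hb rs hrs hrs4 hP, hP⟩
    | succ j ih =>
      have h0 : 0 < L ^ j * rs := by positivity
      have h1 := hcon _ h0 ih.1 ih.2
      have h2 : L ^ (j + 1) * rs = L * (L ^ j * rs) := by ring
      rw [h2]
      refine ⟨hb _ (by positivity) ?_ h1, h1⟩
      calc L * (L ^ j * rs) ≤ L * Rk := by gcongr; exact ih.1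
        _ ≤ _ := hLR
  obtain ⟨j, hj⟩ := pow_unbounded_of_one_lt (Rk / rs) hL
  rw [div_lt_iff₀ hrs] at hj
  linarith [(hall j).1]

section
variable {n : ℕ} {lam G : ℝ} {u : SpaceTime n → ℝ}

lemma reach_point (hlam : 0 < lam) (hG : 0 ≤ G) {q : ℕ}
    (hq : (2*(1/4)+4*2+4*G+8*lam)^2 < 32*lam*q*(1/64))
    (hQ : QS lam G u (ball 0 1 ×ˢ Ioo (-1) 1)) (hu : ContinuousOn u (ball 0 1 ×ˢ Ioo (-1) 1))
    (hpos : ∀ P ∈ (ball (0 : Eucl n) 1 ×ˢ Ioo (-1:ℝ) 1), 0 ≤ u P)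
    {x xq : Eucl n} {t1 tq r m : ℝ} (hm : 0 < m) (hx : ‖x‖ ≤ 5/8) (hxq : ‖xq‖ ≤ 1/2)
    (ht1 : -1 < t1) (ht1' : t1 ≤ 1/4) (htq : 1/2 ≤ tq) (htq' : tq < 1) (hr : 0 < r) (hr4 : r ≤ 1/4)
    (hinit : ∀ w ∈ ball x (r/4), m ≤ u (w, t1)) : m * r ^ (2*q) ≤ u (xq, tq) := by
  have hD : closedBall (0 : Eucl n) (7/8) ×ˢ Icc t1 tq ⊆ ball (0 : Eucl n) 1 ×ˢ Ioo (-1:ℝ) 1 := by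
    rintro ⟨a, b⟩ ⟨ha, hb⟩
    refine ⟨closedBall_subset_ball (by norm_num) ha, by simp only; linarith [hb.1],
      by simp only; linarith [hb.2]⟩
  have hd : dist xq x ≤ 9/8 := by
    rw [dist_eq_norm]; have := norm_sub_le xq x; linarith
  have h := propagation (R1 := r/4) (R2 := 1/4) (β0 := 1/64) (β1 := 1/4) (V := 2) (t1 := t1)
    (t2 := tq) (κ := 7/8) (x₀ := 0) (y := x) (x := xq) hlam hG hQ hu hpos (by linarith)
    (by positivity) (by linarith) hm hD (by rw [dist_zero_right]; linarith)
    (by rw [dist_zero_right]; linarith) hinit (by norm_num) (by nlinarith) (by nlinarith)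
    (by linarith) hq
  have e : r / 4 / (1/4) = r := by ring
  rwa [e] at h

lemma reach_local (hlam : 0 < lam) (hG : 0 ≤ G) {q : ℕ} {L : ℝ} (hL : 1 < L)
    (hq : (2*(3/8)+4*L+4*G+8*lam)^2 < 32*lam*q*(3/(16*L^2)))
    (hQ : QS lam G u (ball 0 1 ×ˢ Ioo (-1) 1)) (hu : ContinuousOn u (ball 0 1 ×ˢ Ioo (-1) 1))
    (hpos : ∀ P ∈ (ball (0 : Eucl n) 1 ×ˢ Ioo (-1:ℝ) 1), 0 ≤ u P)
    {x w : Eucl n} {t1 s r m : ℝ} (hm : 0 < m) (hx : ‖x‖ ≤ 5/8) (hr : 0 < r) (hLr : L * r ≤ 1/8)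
    (ht1 : -1 < t1) (hs1 : t1 + r ^ 2 / 2 ≤ s) (hs2 : s ≤ t1 + L ^ 2 * r ^ 2) (hs : s < 1)
    (hw : dist w x ≤ L * r)
    (hinit : ∀ w ∈ ball x (r/4), m ≤ u (w, t1)) : m * (1/2) ^ (2*q) ≤ u (w, s) := by
  have hrL : r ≤ L * r := by nlinarith
  have hr2 : 0 < r ^ 2 := by positivity
  have hD : closedBall x (L * r + r/2) ×ˢ Icc t1 s ⊆ ball (0 : Eucl n) 1 ×ˢ Ioo (-1:ℝ) 1 := by
    rintro ⟨a, b⟩ ⟨ha, hb⟩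
    simp only [mem_closedBall, dist_eq_norm] at ha
    refine ⟨?_, by simp only; linarith [hb.1], by simp only; linarith [hb.2]⟩
    have : ‖a‖ ≤ ‖a - x‖ + ‖x‖ := by simpa using norm_add_le (a - x) x
    simp only [mem_ball, dist_zero_right]; linarith
  have h := propagation (R1 := r/4) (R2 := r/2) (β0 := 3/(16*L^2)) (β1 := 3/8) (V := L) (t1 := t1)
    (t2 := s) (κ := L * r + r/2) (x₀ := x) (y := x) (x := w) hlam hG hQ hu hpos (by linarith)
    (by positivity) (by linarith) hm hD (by rw [dist_self]; nlinarith)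
    (by linarith) hinit (by positivity) ?_ (by nlinarith)
    ?_ hq
  · have e : r / 4 / (r/2) = 1/2 := by field_simp; norm_num
    rwa [e] at h
  · calc 3/(16*L^2) * (s - t1) ≤ 3/(16*L^2) * (L ^ 2 * r ^ 2) := by gcongr; linarith
      _ = (r/2)^2 - (r/4)^2 := by field_simp; ring
  · calc r/2 * dist w x ≤ r/2 * (L * r) := by gcongr
      _ = L * (r ^ 2/2) := by ring
      _ ≤ L * (s - t1) := by gcongr; linarith

end

def Dk (n k : ℕ) : Set (SpaceTime n) :=
  ball 0 (1/2 + (1/2)^k/8) ×ˢ Ioo (-1) (-1/2 + (1/2)^k/8)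

def Ek {n : ℕ} (u : SpaceTime n → ℝ) (M : ℝ) (k : ℕ) : Set (SpaceTime n) :=
  Dk n k ∩ {P | M ^ k < u P}

lemma half_pow_le (k : ℕ) : ((1:ℝ)/2)^k ≤ 1 := pow_le_one₀ (by norm_num) (by norm_num)

lemma Dk_subset (n k : ℕ) : Dk n k ⊆ ball (0 : Eucl n) 1 ×ˢ Ioo (-1:ℝ) 1 := by
  have := half_pow_le k
  exact Set.prod_mono (ball_subset_ball (by linarith)) (Ioo_subset_Ioo_right (by linarith))

lemma Dk_open (n k : ℕ) : IsOpen (Dk n k) := isOpen_ball.prod isOpen_Ioo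

lemma Dk_succ (n k : ℕ) : Dk n (k+1) ⊆ Dk n k := by
  have : ((1:ℝ)/2)^(k+1) ≤ (1/2)^k := pow_le_pow_of_le_one (by norm_num) (by norm_num) (by omega)
  exact Set.prod_mono (ball_subset_ball (by linarith)) (Ioo_subset_Ioo_right (by linarith))

lemma Dk_volume (n k : ℕ) : volume (Dk n k) ≠ ⊤ := by
  unfold Dk
  rw [Measure.volume_eq_prod, Measure.prod_prod]
  exact ENNReal.mul_ne_top measure_ball_lt_top.ne measure_Ioo_lt_top.ne

lemma Qc_in_Dk {n k : ℕ} {x : Eucl n} {t R : ℝ} (hz : (x, t) ∈ Dk n (k+1)) (hR0 : 0 ≤ R)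
    (hR : R ≤ (1/2)^k/16) : Qc x t R ⊆ Dk n k := by
  have hk := half_pow_le k
  have e : ((1:ℝ)/2)^(k+1) = (1/2)^k/2 := by ring
  obtain ⟨h1, h2⟩ := hz
  simp only [mem_ball, dist_zero_right, mem_Ioo, e] at h1 h2
  rintro ⟨a, b⟩ ⟨ha, hb⟩
  simp only [mem_ball, dist_eq_norm, mem_Ioo] at ha hb
  have : ‖a‖ ≤ ‖a - x‖ + ‖x‖ := by simpa using norm_add_le (a - x) x
  have hRR : R ^ 2 ≤ R := by nlinarith
  refine ⟨?_, by simp only; linarith, by simp only; linarith⟩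
  simp only [mem_ball, dist_zero_right]; linarith

lemma Ek_open {n : ℕ} {u : SpaceTime n → ℝ} (hu : ContinuousOn u (ball 0 1 ×ˢ Ioo (-1) 1)) (M : ℝ)
    (k : ℕ) : IsOpen (Ek u M k) :=
  open_superlevel (Dk_open n k) (hu.mono (Dk_subset n k)) _

lemma Qc_volume {n : ℕ} (x : Eucl n) (t R : ℝ) :
    volume (Qc x t R) = volume (ball x R) * ENNReal.ofReal (R ^ 2) := by
  unfold Qc
  rw [Measure.volume_eq_prod, Measure.prod_prod, Real.volume_Ioo, add_sub_cancel_left]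

lemma Qc_small {n : ℕ} (x : Eucl n) (t : ℝ) {ε : ℝ} (hε : 0 < ε) :
    Qc x t (min (1/4) ε) ⊆ ball (x, t) ε := by
  have hp : 0 < min (1/4) ε := by positivity
  have h1 := min_le_left (1/4) ε
  have h2 := min_le_right (1/4) ε
  generalize min (1/4) ε = s at *
  rintro ⟨a, b⟩ ⟨ha, hb⟩
  simp only [mem_ball, mem_Ioo] at ha hb
  have h3 : s ^ 2 < s := by nlinarith
  rw [mem_ball, Prod.dist_eq, max_lt_iff, Real.dist_eq]
  refine ⟨by simp only; linarith, ?_⟩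
  rw [abs_lt]
  constructor <;> simp only <;> linarith

lemma sq_quarter {r : ℝ} (h0 : 0 ≤ r) (h : r ≤ 1/4) : r ^ 2 ≤ 1/4 := by nlinarith

set_option maxHeartbeats 1000000 in
lemma point_cyl {n : ℕ} {lam G : ℝ} {u : SpaceTime n → ℝ} (hlam : 0 < lam) (hG : 0 ≤ G)
    {μ : ℝ} (hμ0 : 0 < μ) (hμ1 : μ < 1)
    (hgr : ∀ (x : Eucl n) (t r m : ℝ), 0 < r → 0 < m → Qc x t r ⊆ ball 0 1 ×ˢ Ioo (-1) 1 →
      ENNReal.ofReal (1 - μ) * volume (Qc x t r) ≤ volume (Qc x t r ∩ {P | m * 5 < u P}) →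
      ∀ w : Eucl n, dist w x ≤ r / 4 → m ≤ u (w, t + r ^ 2 / 2))
    {L : ℝ} (hL : 1 < L) (hLμ : 1 / L ^ 2 ≤ μ / 2) {q : ℕ}
    (hq1 : (2*(1/4)+4*2+4*G+8*lam)^2 < 32*lam*q*(1/64))
    (hq2 : (2*(3/8)+4*L+4*G+8*lam)^2 < 32*lam*q*(3/(16*L^2)))
    {M : ℝ} (hM : 5 * 2 ^ (2*q) < M)
    (hQ : QS lam G u (ball 0 1 ×ˢ Ioo (-1) 1)) (hu : ContinuousOn u (ball 0 1 ×ˢ Ioo (-1) 1))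
    (hpos : ∀ P ∈ (ball (0 : Eucl n) 1 ×ˢ Ioo (-1:ℝ) 1), 0 ≤ u P)
    {xq : Eucl n} {tq : ℝ} (hxq : ‖xq‖ ≤ 1/2) (htq : 1/2 ≤ tq) (htq' : tq < 1)
    (huq : u (xq, tq) ≤ (1/(16*L^2))^(2*q)) {k : ℕ} {x : Eucl n} {t : ℝ}
    (hz : (x, t) ∈ Ek u M (k+1)) :
    ∃ R, 0 < R ∧ R ≤ 1/16 ∧ ENNReal.ofReal (μ/2) * volume (Qc x t R) ≤
      volume (Qc x t R ∩ (Ek u M k \ Ek u M (k+1))) := by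
  have hhk := half_pow_le k
  have hhk1 := half_pow_le (k+1)
  have hhk0 : (0:ℝ) < (1/2)^k := by positivity
  have hA1 : (1:ℝ) ≤ 2 ^ (2*q) := one_le_pow₀ (by norm_num)
  have hM0 : 0 < M := by linarith
  have hM1 : 1 < M := by linarith
  have hx : ‖x‖ ≤ 5/8 := by
    have := hz.1.1; simp only [mem_ball, dist_zero_right] at this; linarith
  have ht1 : -1 < t := hz.1.2.1
  have ht2 : t < -3/8 := by have := hz.1.2.2; simp only at this; linarith
  set m := M ^ (k+1) / 5 with hm
  have hm0 : 0 < m := by positivity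
  have hm5 : m * 5 = M ^ (k+1) := by rw [hm]; ring
  let P : ℝ → Prop := fun r =>
    ENNReal.ofReal (1 - μ) * volume (Qc x t r) ≤ volume (Qc x t r ∩ Ek u M (k+1))
  have hPinit : ∀ r, 0 < r → r ≤ 1/4 → P r → ∀ w ∈ ball x (r/4), m ≤ u (w, t + r ^ 2/2) := by
    intro r hr hr4 hP w hw
    refine hgr x t r m hr hm0 ?_ (hP.trans (measure_mono ?_)) w (mem_ball.1 hw).le
    · rintro ⟨a, b⟩ ⟨ha, hb⟩
      simp only [mem_ball, dist_eq_norm, mem_Ioo] at ha hb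
      have : ‖a‖ ≤ ‖a - x‖ + ‖x‖ := by simpa using norm_add_le (a - x) x
      have : r ^ 2 ≤ 1/4 := sq_quarter hr.le hr4
      refine ⟨?_, by simp only; linarith, by simp only; linarith⟩
      simp only [mem_ball, dist_zero_right]; linarith
    · rw [hm5]
      exact inter_subset_inter_right _ (fun P hP => hP.2)
  set c0 : ℝ := (1/(16*L^2))^(2*q) with hc0
  have hc00 : 0 < c0 := by positivity
  set Rk : ℝ := (1/2)^k/(16*L^2) with hRk
  have hRk0 : 0 < Rk := by positivity
  have hLRk : L * Rk ≤ (1/2)^k/16 := by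
    have : L * Rk = (1/2)^k/16/L := by rw [hRk]; field_simp
    rw [this]; exact div_le_self (by positivity) hL.le
  have hb : ∀ r, 0 < r → r ≤ 1/4 → P r → r ≤ Rk := by
    intro r hr hr4 hP
    by_contra hc
    push Not at hc
    have hr2 : r ^ 2 ≤ 1/4 := sq_quarter hr.le hr4
    have hr2p : 0 < r ^ 2 := pow_pos hr 2
    have h1 := reach_point hlam hG hq1 hQ hu hpos hm0 hx hxq (t1 := t + r ^ 2/2) (by linarith)
      (by linarith) htq htq' hr hr4 (hPinit r hr hr4 hP)
    have h2 : Rk ^ (2*q) ≤ r ^ (2*q) := by gcongr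
    have h3 : Rk ^ (2*q) = ((1/2:ℝ)^(2*q))^k * c0 := by
      rw [hRk, hc0, div_eq_mul_one_div, mul_pow, ← pow_mul, ← pow_mul, mul_comm k]
    have h4 : (2:ℝ)^(2*q) * (1/2)^(2*q) = 1 := by rw [← mul_pow]; norm_num
    have h5 : ((2:ℝ)^(2*q))^k ≤ M ^ k := by
      apply pow_le_pow_left₀ (by positivity); linarith
    have h6 : M * c0 ≤ M ^ (k+1) * Rk ^ (2*q) := by
      rw [h3]
      calc M * c0 = M * (((2:ℝ)^(2*q))^k * ((1/2:ℝ)^(2*q))^k) * c0 := by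
            rw [← mul_pow, h4]; simp
        _ ≤ M * (M ^ k * ((1/2:ℝ)^(2*q))^k) * c0 := by gcongr
        _ = _ := by ring
    have h7 : M ^ (k+1) * Rk ^ (2*q) ≤ M ^ (k+1) * r ^ (2*q) := by gcongr
    have h8 : m * r ^ (2*q) = M ^ (k+1) * r ^ (2*q) / 5 := by rw [hm]; ring
    have h9 : 5 * c0 < M * c0 := by gcongr; linarith
    linarith
  -- small scale
  have hopen := Ek_open hu M (k+1)
  obtain ⟨ε, hε, hεs⟩ := Metric.isOpen_iff.1 hopen _ hz
  have hPs : P (min (1/4) ε) := by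
    have hsub : Qc x t (min (1/4) ε) ⊆ Ek u M (k+1) :=
      (Qc_small x t hε).trans hεs
    show _ ≤ _
    rw [inter_eq_left.2 hsub]
    calc _ ≤ 1 * volume (Qc x t (min (1/4) ε)) := by
          gcongr; rw [ENNReal.ofReal_le_one]; linarith
      _ = _ := one_mul _
  obtain ⟨r, hr, hrR, hPr, hnP⟩ := pick_scale hL (by positivity) (min_le_left _ _) hPs hb
    (by linarith)
  have hLr : L * r ≤ (1/2)^k/16 := le_trans (by gcongr) hLRk
  have hR0 : 0 < L * r := by positivity
  have hrLr : r ≤ L * r := le_mul_of_one_le_left hr.le hL.le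
  have hr2p : 0 < r ^ 2 := pow_pos hr 2
  have hr4 : r ≤ 1/4 := by linarith
  refine ⟨L * r, hR0, by linarith, ?_⟩
  have hinit := hPinit r hr hr4 hPr
  have hQsub := Qc_in_Dk hz.1 hR0.le hLr
  set Q := Qc x t (L * r) with hQdef
  have hQt : volume Q ≠ ⊤ := Qc_volume_ne_top _ _ _
  have hr2 : r ^ 2 ≤ 1/4 := sq_quarter hr.le hr4
  have hLr2 : L ^ 2 * r ^ 2 ≤ 1/4 := by rw [← mul_pow]; exact sq_quarter hR0.le (by linarith)
  have hcov : Q ⊆ (Q ∩ (Ek u M k \ Ek u M (k+1))) ∪ (Q ∩ Ek u M (k+1)) ∪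
      (ball x (L * r) ×ˢ Ioc t (t + r ^ 2)) := by
    rintro ⟨w, s⟩ hws
    by_cases hE : (w, s) ∈ Ek u M (k+1)
    · exact Or.inl (Or.inr ⟨hws, hE⟩)
    by_cases hs : s ≤ t + r ^ 2
    · exact Or.inr ⟨hws.1, hws.2.1, hs⟩
    push Not at hs
    refine Or.inl (Or.inl ⟨hws, ⟨hQsub hws, ?_⟩, hE⟩)
    have hs2 : s < t + (L * r) ^ 2 := hws.2.2
    rw [mul_pow] at hs2
    have h := reach_local hlam hG hL hq2 hQ hu hpos hm0 hx hr (by linarith) (t1 := t + r ^ 2/2) (s := s)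
      (by linarith) (by linarith) (by linarith) (by linarith) (mem_ball.1 hws.1).le hinit
    refine lt_of_lt_of_le ?_ h
    have h4 : (2:ℝ)^(2*q) * (1/2)^(2*q) = 1 := by rw [← mul_pow]; norm_num
    have h5 : m * (1/2)^(2*q) = M ^ k * (M * (1/2)^(2*q)) / 5 := by rw [hm]; ring
    have h6 : 5 < M * (1/2)^(2*q) := by
      calc (5:ℝ) = 5 * 2^(2*q) * (1/2)^(2*q) := by rw [mul_assoc, h4]; norm_num
        _ < _ := by gcongr
    have h7 : 0 < M ^ k := by positivity
    rw [h5]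
    have h8 := mul_lt_mul_of_pos_left h6 h7
    linarith
  have hslab : volume (ball x (L * r) ×ˢ Ioc t (t + r ^ 2)) ≤ ENNReal.ofReal (μ/2) * volume Q := by
    rw [hQdef, Qc_volume, Measure.volume_eq_prod, Measure.prod_prod, Real.volume_Ioc,
      add_sub_cancel_left, mul_left_comm, ← ENNReal.ofReal_mul (by positivity)]
    gcongr
    have : r ^ 2 = (1/L^2) * (L * r)^2 := by field_simp
    calc r ^ 2 = (1/L^2) * (L * r)^2 := this
      _ ≤ _ := by gcongr
  have htot : volume Q ≤ volume (Q ∩ (Ek u M k \ Ek u M (k+1))) +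
      ENNReal.ofReal (1 - μ) * volume Q + ENNReal.ofReal (μ/2) * volume Q := by
    refine (measure_mono hcov).trans ((measure_union_le _ _).trans ?_)
    refine add_le_add ((measure_union_le _ _).trans (add_le_add le_rfl ?_)) hslab
    exact (not_le.1 hnP).le
  have hsplit : volume Q = ENNReal.ofReal (μ/2) * volume Q +
      (ENNReal.ofReal (1 - μ) * volume Q + ENNReal.ofReal (μ/2) * volume Q) := by
    rw [← add_mul, ← add_mul, ← ENNReal.ofReal_add (by linarith) (by linarith),
      ← ENNReal.ofReal_add (by linarith) (by linarith)]
    have : μ/2 + (1 - μ + μ/2) = 1 := by ring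
    rw [this]; simp
  rw [add_assoc] at htot
  nth_rewrite 1 [hsplit] at htot
  refine (ENNReal.add_le_add_iff_right ?_).1 htot
  exact ENNReal.add_ne_top.2 ⟨ENNReal.mul_ne_top ENNReal.ofReal_ne_top hQt,
    ENNReal.mul_ne_top ENNReal.ofReal_ne_top hQt⟩

lemma enlarged_volume {n : ℕ} (x : Eucl n) (t : ℝ) {R : ℝ} (hR : 0 < R) :
    volume (ball x (3 * R) ×ˢ Ioo (t - 4 * R ^ 2) (t + R ^ 2)) =
      ENNReal.ofReal (3 ^ n * 5) * volume (Qc x t R) := by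
  rw [Qc_volume, Measure.volume_eq_prod, Measure.prod_prod, Real.volume_Ioo,
    Measure.addHaar_ball_of_pos _ _ hR, Measure.addHaar_ball_of_pos _ _ (by positivity : 0 < 3 * R),
    finrank_euclideanSpace_fin]
  have e : t + R ^ 2 - (t - 4 * R ^ 2) = 5 * R ^ 2 := by ring
  rw [e, mul_pow, ENNReal.ofReal_mul (by positivity), ENNReal.ofReal_mul (by positivity),
    ENNReal.ofReal_mul (by positivity)]
  ring

/-- covering argument -/
lemma covering_step {n : ℕ} {E F : Set (SpaceTime n)} {c : ℝ} (hc : 0 < c) (hF : MeasurableSet F)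
    (h : ∀ z ∈ E, ∃ R, 0 < R ∧ R ≤ 1/16 ∧ ENNReal.ofReal c * volume (Qc z.1 z.2 R) ≤
      volume (Qc z.1 z.2 R ∩ F)) :
    volume E ≤ ENNReal.ofReal (3 ^ n * 5 / c) * volume F := by
  choose! R hR0 hR1 hRv using h
  have hne : ∀ a ∈ E, (Qc a.1 a.2 (R a)).Nonempty := by
    intro a ha
    have := hR0 a ha
    refine ⟨(a.1, a.2 + R a ^ 2/2), mem_ball_self this, ?_, ?_⟩ <;> simp only <;> nlinarith
  obtain ⟨v, hvE, hdisj, hcov⟩ := Vitali.exists_disjoint_subfamily_covering_enlargement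
    (fun a : SpaceTime n => Qc a.1 a.2 (R a)) E R 2 (by norm_num) (fun a ha => (hR0 a ha).le) (1/16)
    hR1 hne
  have hvc : v.Countable := hdisj.countable_of_isOpen (fun a _ => Qc_open _ _ _)
    (fun a ha => hne a (hvE ha))
  have hsub : E ⊆ ⋃ b ∈ v, ball b.1 (3 * R b) ×ˢ Ioo (b.2 - 4 * R b ^ 2) (b.2 + R b ^ 2) := by
    intro a ha
    obtain ⟨b, hb, ⟨P, hPa, hPb⟩, hab⟩ := hcov a ha
    simp only [mem_iUnion]
    refine ⟨b, hb, ?_⟩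
    have h0a := hR0 a ha
    have h0b := hR0 b (hvE hb)
    obtain ⟨a1, a2⟩ := hPa
    obtain ⟨b1, b2⟩ := hPb
    simp only [mem_ball, mem_Ioo] at a1 a2 b1 b2
    have h2 : R a ^ 2 ≤ 4 * R b ^ 2 := by
      calc R a ^ 2 ≤ (2 * R b) ^ 2 := by gcongr
        _ = _ := by ring
    refine ⟨?_, ?_, ?_⟩
    · rw [mem_ball]
      have := dist_triangle_left a.1 b.1 P.1
      linarith
    · linarith
    · linarith
  have hcR : ENNReal.ofReal c ≠ 0 := by simpa using hc
  calc volume E ≤ volume (⋃ b ∈ v, ball b.1 (3 * R b) ×ˢ Ioo (b.2 - 4 * R b ^ 2) (b.2 + R b ^ 2)) :=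
        measure_mono hsub
    _ ≤ ∑' b : v, volume (ball (b : SpaceTime n).1 (3 * R b) ×ˢ
          Ioo ((b : SpaceTime n).2 - 4 * R b ^ 2) ((b : SpaceTime n).2 + R b ^ 2)) :=
        measure_biUnion_le _ hvc _
    _ ≤ ∑' b : v, ENNReal.ofReal (3 ^ n * 5 / c) *
          volume (Qc (b : SpaceTime n).1 (b : SpaceTime n).2 (R b) ∩ F) := by
        apply ENNReal.tsum_le_tsum
        intro b
        rw [enlarged_volume _ _ (hR0 b (hvE b.2))]
        calc _ = ENNReal.ofReal (3 ^ n * 5 / c) * (ENNReal.ofReal c *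
              volume (Qc (b : SpaceTime n).1 (b : SpaceTime n).2 (R b))) := by
              rw [← mul_assoc, ← ENNReal.ofReal_mul (by positivity)]
              congr 2; field_simp
          _ ≤ _ := by gcongr; exact hRv b (hvE b.2)
    _ = ENNReal.ofReal (3 ^ n * 5 / c) * volume (⋃ b ∈ v, Qc b.1 b.2 (R b) ∩ F) := by
        rw [ENNReal.tsum_mul_left, measure_biUnion hvc]
        · exact hdisj.mono (fun b => inter_subset_left)
        · intro b _; exact (Qc_open _ _ _).measurableSet.inter hF
    _ ≤ _ := by
        gcongr
        exact iUnion₂_subset fun b _ => inter_subset_right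

lemma decay (n : ℕ) {lam G : ℝ} (hlam : 0 < lam) (hG : 0 ≤ G) :
    ∃ η M θ : ℝ, 0 < η ∧ 1 < M ∧ 0 < θ ∧ θ < 1 ∧ ∀ u : SpaceTime n → ℝ,
    QS lam G u (ball 0 1 ×ˢ Ioo (-1) 1) → ContinuousOn u (ball 0 1 ×ˢ Ioo (-1) 1) →
    (∀ P ∈ (ball (0 : Eucl n) 1 ×ˢ Ioo (-1:ℝ) 1), 0 < u P) →
    ∀ xq tq, ‖xq‖ ≤ 1/2 → 1/2 ≤ tq → tq < 1 → u (xq, tq) ≤ η →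
    ∀ k : ℕ, volume (Ek u M k) ≤ ENNReal.ofReal (θ ^ k) * volume (Dk n 0) := by
  obtain ⟨μ, hμ0, hμ1, hgr⟩ := growth n hlam hG
  set L : ℝ := 1 + 2/μ with hLdef
  have hL : 1 < L := by have : 0 < 2/μ := by positivity
                        linarith
  have hLμ : 1 / L ^ 2 ≤ μ/2 := by
    have h1 : 2/μ ≤ L ^ 2 := by nlinarith
    rw [div_le_iff₀ (by positivity)]
    calc (1:ℝ) = μ/2 * (2/μ) := by field_simp
      _ ≤ _ := by gcongr
  obtain ⟨q1, hq1⟩ := exists_nat_gt ((2*(1/4)+4*2+4*G+8*lam)^2 / (32*lam*(1/64)))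
  obtain ⟨q2, hq2⟩ := exists_nat_gt ((2*(3/8)+4*L+4*G+8*lam)^2 / (32*lam*(3/(16*L^2))))
  set q := max q1 q2 with hq
  have hq1' : (2*(1/4)+4*2+4*G+8*lam)^2 < 32*lam*(q:ℝ)*(1/64) := by
    have : (q1:ℝ) ≤ q := by exact_mod_cast le_max_left _ _
    have h2 := hq1.trans_le this
    rw [div_lt_iff₀ (by positivity)] at h2
    linarith
  have hq2' : (2*(3/8)+4*L+4*G+8*lam)^2 < 32*lam*(q:ℝ)*(3/(16*L^2)) := by
    have : (q2:ℝ) ≤ q := by exact_mod_cast le_max_right _ _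
    have h2 := hq2.trans_le this
    rw [div_lt_iff₀ (by positivity)] at h2
    linarith
  set M : ℝ := 6 * 2 ^ (2*q) with hMdef
  have hA1 : (1:ℝ) ≤ 2 ^ (2*q) := one_le_pow₀ (by norm_num)
  have hM : 5 * 2 ^ (2*q) < M := by rw [hMdef]; linarith
  have hM1 : 1 < M := by linarith
  set K : ℝ := 3 ^ n * 5 / (μ/2) with hK
  have hK0 : 0 < K := by positivity
  refine ⟨(1/(16*L^2))^(2*q), M, K / (1 + K), by positivity, hM1, by positivity, ?_, ?_⟩
  · rw [div_lt_one (by positivity)]; linarith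
  intro u hQ hu hpos xq tq hxq htq htq' huq
  have step : ∀ k, volume (Ek u M (k+1)) ≤ ENNReal.ofReal (K/(1+K)) * volume (Ek u M k) := by
    intro k
    have hsub : Ek u M (k+1) ⊆ Ek u M k := by
      rintro P ⟨h1, h2⟩
      have h3 : M ^ k ≤ M ^ (k+1) := pow_le_pow_right₀ hM1.le (by omega)
      have h4 : M ^ (k+1) < u P := h2
      exact ⟨Dk_succ n k h1, h3.trans_lt h4⟩
    have o1 := Ek_open hu M k
    have o2 := Ek_open hu M (k+1)
    have hcs := covering_step (E := Ek u M (k+1)) (F := Ek u M k \ Ek u M (k+1)) (half_pos hμ0)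
      (o1.measurableSet.diff o2.measurableSet)
      (fun z hz => point_cyl hlam hG hμ0 hμ1
        (fun x t r m hr hm hs hd => hgr u _ x t r m hQ hu hpos hr hm hs hd) hL hLμ hq1' hq2' hM hQ hu
        (fun P hP => (hpos P hP).le) hxq htq htq' huq hz)
    rw [← hK] at hcs
    have hsum : volume (Ek u M (k+1)) + volume (Ek u M k \ Ek u M (k+1)) = volume (Ek u M k) := by
      have := measure_inter_add_sdiff (μ := volume) (Ek u M k) o2.measurableSet
      rwa [inter_eq_right.2 hsub] at this
    set a := volume (Ek u M (k+1))
    set d := volume (Ek u M k \ Ek u M (k+1))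
    rw [← hsum]
    have e1 : ENNReal.ofReal (K/(1+K)) * (a + d) =
        ENNReal.ofReal (K/(1+K)) * a + ENNReal.ofReal (1/(1+K)) * (ENNReal.ofReal K * d) := by
      rw [mul_add, ← mul_assoc, ← ENNReal.ofReal_mul (by positivity)]
      congr 3; ring
    rw [e1]
    calc a = ENNReal.ofReal (K/(1+K)) * a + ENNReal.ofReal (1/(1+K)) * a := by
          rw [← add_mul, ← ENNReal.ofReal_add (by positivity) (by positivity)]
          have : K/(1+K) + 1/(1+K) = 1 := by field_simp; ring
          rw [this]; simp
      _ ≤ _ := by gcongr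
  intro k
  induction k with
  | zero => simpa using measure_mono (μ := volume) (show Ek u M 0 ⊆ Dk n 0 from inter_subset_left)
  | succ k ih =>
    refine (step k).trans ?_
    calc _ ≤ ENNReal.ofReal (K/(1+K)) * (ENNReal.ofReal ((K/(1+K)) ^ k) * volume (Dk n 0)) := by
          gcongr
      _ = _ := by
          rw [← mul_assoc, ← ENNReal.ofReal_mul (by positivity)]
          congr 2; ring

lemma exists_exponent {M θ : ℝ} (hM : 1 < M) (hθ0 : 0 < θ) (hθ : θ < 1) :
    ∃ p : ℝ, 0 < p ∧ p < 1 ∧ M ^ p * θ < 1 := by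
  have hlM : 0 < Real.log M := Real.log_pos hM
  have hlθ : Real.log θ < 0 := Real.log_neg hθ0 hθ
  refine ⟨min (1/2) (-Real.log θ / (2 * Real.log M)), lt_min (by norm_num)
    (div_pos (by linarith) (by positivity)), (min_le_left _ _).trans_lt (by norm_num), ?_⟩
  set p := min (1/2) (-Real.log θ / (2 * Real.log M))
  have hp : p * (2 * Real.log M) ≤ -Real.log θ := by
    rw [← le_div_iff₀ (by positivity)]; exact min_le_right _ _
  have h1 : M ^ p * θ = Real.exp (Real.log M * p + Real.log θ) := by
    rw [Real.exp_add, Real.exp_log hθ0, Real.rpow_def_of_pos (by linarith)]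
  rw [h1, Real.exp_lt_one_iff]
  linarith

lemma exists_level {M f : ℝ} (hM : 1 < M) (hf : 1 < f) : ∃ k : ℕ, M ^ k < f ∧ f ≤ M ^ (k+1) := by
  classical
  have hex : ∃ k : ℕ, f ≤ M ^ k := (pow_unbounded_of_one_lt f hM).imp fun _ h => h.le
  have h1 := Nat.find_spec hex
  cases hk : Nat.find hex with
  | zero => rw [hk, pow_zero] at h1; linarith
  | succ k =>
    rw [hk] at h1
    refine ⟨k, ?_, h1⟩
    have := Nat.find_min hex (m := k) (by omega)
    exact not_le.1 this

lemma layer_bound {α : Type*} [MeasurableSpace α] {μ : Measure α} {S : Set α} (hS : MeasurableSet S)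
    {f : α → ℝ} (hf : ∀ x ∈ S, 0 < f x) {M θ p V W : ℝ} (hM : 1 < M) (hθ : 0 < θ) (hp : 0 < p)
    (hMθ : M ^ p * θ < 1) (hV : 0 ≤ V) (hW : 0 ≤ W) (hSV : μ S ≤ ENNReal.ofReal V)
    (hm : ∀ k : ℕ, MeasurableSet (S ∩ {x | M ^ k < f x}))
    (hk : ∀ k : ℕ, μ (S ∩ {x | M ^ k < f x}) ≤ ENNReal.ofReal (θ ^ k * W)) :
    ∫ x in S, f x ^ p ∂μ ≤ V + M ^ p / (1 - M ^ p * θ) * W := by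
  have hA0 : 0 < M ^ p := Real.rpow_pos_of_pos (by linarith) p
  set A := M ^ p with hA
  have hsum : HasSum (fun k : ℕ => A ^ (k+1) * (θ ^ k * W)) (A / (1 - A * θ) * W) := by
    have h := (hasSum_geometric_of_lt_one (by positivity : 0 ≤ A * θ) hMθ).mul_left (A * W)
    have e1 : (fun k : ℕ => A ^ (k+1) * (θ ^ k * W)) = fun k => A * W * (A * θ) ^ k := by
      funext k; rw [mul_pow]; ring
    have e2 : A / (1 - A * θ) * W = A * W * (1 - A * θ)⁻¹ := by rw [div_eq_mul_inv]; ring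
    rw [e1, e2]; exact h
  have hpt : ∀ x ∈ S, ‖f x ^ p‖ₑ ≤ 1 + ∑' k : ℕ, (S ∩ {x | M ^ k < f x}).indicator
      (fun _ => ENNReal.ofReal (A ^ (k+1))) x := by
    intro x hx
    have h0 := hf x hx
    rw [Real.enorm_of_nonneg (Real.rpow_nonneg h0.le p)]
    by_cases h1 : f x ≤ 1
    · refine le_trans ?_ le_self_add
      rw [ENNReal.ofReal_le_one]
      exact Real.rpow_le_one h0.le h1 hp.le
    · push Not at h1
      obtain ⟨k, hk1, hk2⟩ := exists_level hM h1
      refine le_trans ?_ le_add_self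
      refine le_trans ?_ (ENNReal.le_tsum k)
      rw [indicator_of_mem (show x ∈ S ∩ {x | M ^ k < f x} from ⟨hx, hk1⟩)]
      apply ENNReal.ofReal_le_ofReal
      calc f x ^ p ≤ (M ^ (k+1)) ^ p := Real.rpow_le_rpow h0.le hk2 hp.le
        _ = A ^ (k+1) := by
          rw [hA, ← Real.rpow_natCast, ← Real.rpow_natCast, ← Real.rpow_mul (by linarith),
            ← Real.rpow_mul (by linarith), mul_comm]
  have hB0 : 0 ≤ A / (1 - A * θ) * W := mul_nonneg (div_nonneg hA0.le (by linarith)) hW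
  have hl : ∫⁻ x in S, ‖f x ^ p‖ₑ ∂μ ≤ ENNReal.ofReal (V + A / (1 - A * θ) * W) := by
    calc _ ≤ ∫⁻ x in S, (1 + ∑' k : ℕ, (S ∩ {x | M ^ k < f x}).indicator
              (fun _ => ENNReal.ofReal (A ^ (k+1))) x) ∂μ := setLIntegral_mono' hS hpt
      _ = μ S + ∑' k : ℕ, ∫⁻ x in S, (S ∩ {x | M ^ k < f x}).indicator
              (fun _ => ENNReal.ofReal (A ^ (k+1))) x ∂μ := by
          rw [lintegral_add_left measurable_const, lintegral_tsum]
          · simp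
          · intro k; exact (measurable_const.indicator (hm k)).aemeasurable
      _ ≤ ENNReal.ofReal V + ∑' k : ℕ, ENNReal.ofReal (A ^ (k+1) * (θ ^ k * W)) := by
          refine add_le_add hSV (ENNReal.tsum_le_tsum fun k => ?_)
          rw [lintegral_indicator_const (hm k), ENNReal.ofReal_mul (by positivity)]
          gcongr
          exact (Measure.restrict_apply_le _ _).trans (hk k)
      _ = _ := by
          rw [← ENNReal.ofReal_tsum_of_nonneg (fun k => by positivity) hsum.summable, hsum.tsum_eq,
            ENNReal.ofReal_add hV hB0]
  have h3 := (enorm_integral_le_lintegral_enorm (μ := μ.restrict S) (fun x => f x ^ p)).trans hl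
  rw [← ofReal_norm, ENNReal.ofReal_le_ofReal_iff (by positivity)] at h3
  exact (le_abs_self _).trans h3

/-- **Weak Harnack inequality.** There are `C̃ > 0` and `p ∈ (0,1)`, depending only on
`n, Λ`, such that any continuous `u > 0` on `C_r(x₀,t₀)` satisfying, in the viscosity
sense, `u_t ≥ P⁻(D²u, Λ⁻¹, Λ)` there satisfies
`(⨍_{C⁻_{r/2}} u^p)^{1/p} ≤ C̃ · inf_{C⁺_{r/2}} u`. -/
theorem weak_harnack {n : ℕ} (hn : 1 ≤ n) (Λ : ℝ) (hΛ : 1 ≤ Λ) :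
    ∃ C : ℝ, ∃ pexp : ℝ, 0 < C ∧ 0 < pexp ∧ pexp < 1 ∧
      ∀ (r : ℝ) (x₀ : Eucl n) (t₀ : ℝ) (u : SpaceTime n → ℝ),
        0 < r →
        ContinuousOn u (cylC x₀ t₀ r) →
        (∀ p ∈ cylC x₀ t₀ r, 0 < u p) →
        ViscSup (fun H => pucciMinus H Λ⁻¹ Λ) u (cylC x₀ t₀ r) →
        ∀ q ∈ cylCplus x₀ t₀ r,
          ((volume (cylCminus x₀ t₀ r)).toReal⁻¹ *
              ∫ p in cylCminus x₀ t₀ r, u p ^ pexp) ^ pexp⁻¹ ≤ C * u q := by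
  have hlam : 0 < Λ⁻¹ := by positivity
  have hG : 0 ≤ Λ * n := by positivity
  obtain ⟨η, M, θ, hη, hM, hθ0, hθ1, hdec⟩ := decay n hlam hG
  obtain ⟨p, hp0, hp1, hMp⟩ := exists_exponent hM hθ0 hθ1
  set S1 : Set (SpaceTime n) := ball 0 (1/2) ×ˢ Ioo (-1) (-(1/2)) with hS1
  have hS1k : ∀ k, S1 ⊆ Dk n k := by
    intro k
    have : (0:ℝ) < (1/2)^k := by positivity
    exact prod_mono (ball_subset_ball (by linarith)) (Ioo_subset_Ioo le_rfl (by linarith))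
  have hS1o : IsOpen S1 := isOpen_ball.prod isOpen_Ioo
  have hS1ne : S1.Nonempty := ⟨(0, -(3/4)), mem_ball_self (by norm_num), by norm_num, by norm_num⟩
  have hD0t : volume (Dk n 0) ≠ ⊤ := Dk_volume n 0
  have hS1t : volume S1 ≠ ⊤ := ne_top_of_le_ne_top hD0t (measure_mono (hS1k 0))
  set V1 := (volume S1).toReal with hV1
  set V0 := (volume (Dk n 0)).toReal with hV0
  have hV1p : 0 < V1 := ENNReal.toReal_pos (hS1o.measure_pos volume hS1ne).ne' hS1t
  have hV0p : 0 ≤ V0 := ENNReal.toReal_nonneg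
  set B := M ^ p / (1 - M ^ p * θ) with hB
  have hBp : 0 ≤ B := div_nonneg (Real.rpow_nonneg (by linarith) _) (by linarith)
  set C1 := 1 + B * V0 / V1 with hC1
  have hC1p : 0 < C1 := by positivity
  refine ⟨C1 ^ p⁻¹ / η, p, by positivity, hp0, hp1, ?_⟩
  intro r x₀ t₀ u hr hu hpos hv q hq
  have hr2 : 0 < r ^ 2 := by positivity
  have hqC : q ∈ cylC x₀ t₀ r :=
    ⟨ball_subset_ball (by linarith) hq.1, by linarith [hq.2.1], hq.2.2⟩
  have hq0 := hpos q hqC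
  set m := u q / η with hm
  have hm0 : 0 < m := div_pos hq0 hη
  have hmem : ∀ P ∈ ball (0 : Eucl n) 1 ×ˢ Ioo (-1:ℝ) 1, Phi x₀ t₀ r P ∈ cylC x₀ t₀ r := by
    rintro P ⟨h1, h2⟩
    have h3 := (Phi_mem_ball x₀ t₀ hr P 1).2 h1
    have h4 := (Phi_mem_Ioo x₀ t₀ hr P (-1) 1).2 h2
    rw [mul_one] at h3
    rw [mul_one, mul_neg, mul_one, ← sub_eq_add_neg] at h4
    exact ⟨h3, h4⟩
  have hpre : Phi x₀ t₀ r ⁻¹' (cylCminus x₀ t₀ r) = S1 := by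
    ext P
    have h3 := Phi_mem_ball x₀ t₀ hr P (1/2)
    have h4 := Phi_mem_Ioo x₀ t₀ hr P (-1) (-(1/2))
    have e1 : r * (1/2) = r/2 := by ring
    have e2 : t₀ + r ^ 2 * (-1) = t₀ - r ^ 2 := by ring
    have e3 : t₀ + r ^ 2 * (-(1/2)) = t₀ - r ^ 2 / 2 := by ring
    rw [e1] at h3
    rw [e2, e3] at h4
    exact and_congr h3 h4
  set v : SpaceTime n → ℝ := fun P => u (Phi x₀ t₀ r P) / m with hvdef
  have hQ : QS Λ⁻¹ (Λ * n) v (ball 0 1 ×ˢ Ioo (-1) 1) := (hv.qs hΛ).scale x₀ t₀ hr hm0 hmem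
  have hvc : ContinuousOn v (ball 0 1 ×ˢ Ioo (-1) 1) :=
    (hu.comp (Phi_continuous x₀ t₀ r).continuousOn hmem).div_const m
  have hvp : ∀ P ∈ ball (0 : Eucl n) 1 ×ˢ Ioo (-1:ℝ) 1, 0 < v P := fun P hP =>
    div_pos (hpos _ (hmem P hP)) hm0
  set xq : Eucl n := r⁻¹ • (q.1 - x₀) with hxq
  set tq : ℝ := (q.2 - t₀) / r ^ 2 with htq
  have hPq : Phi x₀ t₀ r (xq, tq) = q := by
    refine Prod.ext ?_ ?_
    · simp only [Phi, hxq, smul_smul, mul_inv_cancel₀ hr.ne', one_smul, add_sub_cancel]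
    · simp only [Phi, htq]; field_simp; ring
  have hxq' : ‖xq‖ ≤ 1/2 := by
    have h3 := Phi_mem_ball x₀ t₀ hr (xq, tq) (1/2)
    rw [hPq, mul_one_div] at h3
    have := h3.1 hq.1
    rw [mem_ball, dist_zero_right] at this
    exact this.le
  have ht4 := Phi_mem_Ioo x₀ t₀ hr (xq, tq) (1/2) 1
  rw [hPq, mul_one_div, mul_one] at ht4
  have ht5 := ht4.1 hq.2
  have hvq : v (xq, tq) ≤ η := by
    rw [hvdef]; simp only [hPq, hm]
    rw [div_div_cancel₀ hq0.ne']
  have hdk := hdec v hQ hvc hvp xq tq hxq' ht5.1.le ht5.2 hvq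
  set S := cylCminus x₀ t₀ r with hS
  have hSo : IsOpen S := isOpen_ball.prod isOpen_Ioo
  have hSC : S ⊆ cylC x₀ t₀ r :=
    prod_mono (ball_subset_ball (by linarith)) (Ioo_subset_Ioo le_rfl (by linarith))
  set a := r ^ (n + 2) with ha
  have ha0 : 0 < a := by positivity
  have hvol : ∀ A : Set (SpaceTime n), MeasurableSet A →
      volume A = ENNReal.ofReal a * volume (Phi x₀ t₀ r ⁻¹' A) := by
    intro A hA
    rw [Phi_volume x₀ t₀ hr hA, ← mul_assoc, ← ENNReal.ofReal_mul ha0.le, ← ha,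
      mul_inv_cancel₀ ha0.ne', ENNReal.ofReal_one, one_mul]
  have hSv : volume S = ENNReal.ofReal (a * V1) := by
    rw [hvol S hSo.measurableSet, hpre, ENNReal.ofReal_mul ha0.le, hV1, ENNReal.ofReal_toReal hS1t]
  have hko : ∀ k : ℕ, IsOpen (S ∩ {x | M ^ k < u x / m}) := fun k =>
    open_superlevel hSo ((hu.mono hSC).div_const m) (M ^ k)
  have hkey := layer_bound (μ := volume) hSo.measurableSet (f := fun P => u P / m) (V := a * V1)
    (W := a * V0) (fun P hP => div_pos (hpos P (hSC hP)) hm0) hM hθ0 hp0 hMp (by positivity)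
    (by positivity) hSv.le (fun k => (hko k).measurableSet) (by
      intro k
      rw [hvol _ (hko k).measurableSet, mul_left_comm, ENNReal.ofReal_mul ha0.le,
        ENNReal.ofReal_mul (by positivity), hV0, ENNReal.ofReal_toReal hD0t]
      gcongr
      refine (measure_mono ?_).trans (hdk k)
      intro P hP
      have h1 : P ∈ S1 := by rw [← hpre]; exact hP.1
      exact ⟨hS1k k h1, hP.2⟩)
  have hint : ∫ P in S, u P ^ p = m ^ p * ∫ P in S, (u P / m) ^ p := by
    rw [← integral_const_mul]
    refine setIntegral_congr_fun hSo.measurableSet ?_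
    intro P hP
    simp only
    rw [← Real.mul_rpow hm0.le (div_pos (hpos P (hSC hP)) hm0).le, mul_div_cancel₀ _ hm0.ne']
  have hSr : (volume S).toReal = a * V1 := by rw [hSv, ENNReal.toReal_ofReal (by positivity)]
  have hI0 : 0 ≤ ∫ P in S, (u P / m) ^ p :=
    setIntegral_nonneg hSo.measurableSet
      (fun P hP => Real.rpow_nonneg (div_pos (hpos P (hSC hP)) hm0).le p)
  have hmp : 0 < m ^ p := Real.rpow_pos_of_pos hm0 p
  have havg : (volume S).toReal⁻¹ * ∫ P in S, u P ^ p ≤ m ^ p * C1 := by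
    rw [hint, hSr, mul_left_comm]
    refine mul_le_mul_of_nonneg_left ?_ hmp.le
    rw [inv_mul_le_iff₀ (by positivity)]
    refine hkey.trans (le_of_eq ?_)
    rw [hC1, ← hB]; field_simp
  calc _ ≤ (m ^ p * C1) ^ p⁻¹ := by
        refine Real.rpow_le_rpow ?_ havg (by positivity)
        rw [hint]; positivity
    _ = C1 ^ p⁻¹ / η * u q := by
        rw [Real.mul_rpow hmp.le hC1p.le, Real.rpow_rpow_inv hm0.le hp0.ne', hm]; ring
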